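/- arXiv:1909.11441 — 2 statements merged into one kernel-verified Lean document; each statement's English description precedes it below -/
import Mathlib

section
/- Let N ≥ 2 and 1 < α < N. There exist constants ε₁ > 0 and C > 0, depending only on N and α, with the following property. Let 0 < ε < ε₁, z ∈ ℝ^N, and let E' ⊆ ℝ^N be a measurable set of measure ω_N with B_z(1−ε) ⊆ E' ⊆ B_z(1+ε). If δ(E') > C·√(D(E')), then there exist two measurable functions u⁺, u⁻ : 𝕊^{N−1} → [0, ε) such that the set E'' = { z + t·x : x ∈ 𝕊^{N−1}, t ∈ [0, 1−u⁻(x)) ∪ (1, 1+u⁺(x)) } has measure ω_N and satisfies D(E'') ≤ D(E') and δ(E'') ≥ δ(E')/2. -/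
open MeasureTheory Metric
open scoped symmDiff

noncomputable def rieszEnergy (N : ℕ) (α : ℝ) (E : Set (EuclideanSpace ℝ (Fin N))) : ℝ :=
  ∫ x in E, ∫ y in E, ‖y - x‖ ^ (α - (N : ℝ))

noncomputable def deficit (N : ℕ) (α : ℝ) (E : Set (EuclideanSpace ℝ (Fin N))) : ℝ :=
  rieszEnergy N α (ball (0 : EuclideanSpace ℝ (Fin N)) 1) - rieszEnergy N α E

noncomputable def asymmetry (N : ℕ) (E : Set (EuclideanSpace ℝ (Fin N))) : ℝ :=
  ⨅ x : EuclideanSpace ℝ (Fin N), (volume (ball x 1 ∆ E)).toReal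

namespace RieszRearrangement

open scoped ENNReal RealInnerProductSpace

variable {N : ℕ}

/-- Euclidean space of dimension `N`. -/
abbrev Eu (N : ℕ) := EuclideanSpace ℝ (Fin N)

/-- The Riesz kernel `|x - y|^{-a}` with values in `[0, ∞]`. -/
noncomputable def kernel (a : ℝ) (x y : Eu N) : ℝ≥0∞ := ‖x - y‖ₑ ^ (-a)

theorem kernel_comm (a : ℝ) (x y : Eu N) : kernel a x y = kernel a y x := by
  rw [kernel, kernel, enorm_sub_rev]

theorem measurable_kernel (a : ℝ) : Measurable (fun p : Eu N × Eu N => kernel a p.1 p.2) := by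
  unfold kernel
  fun_prop

theorem measurable_kernel_right (a : ℝ) (x : Eu N) : Measurable (kernel a x) := by
  unfold kernel
  fun_prop

theorem kernel_eq_ofReal {a : ℝ} {x y : Eu N} (h : x ≠ y) :
    kernel a x y = ENNReal.ofReal (‖x - y‖ ^ (-a)) := by
  have : 0 < ‖x - y‖ := norm_pos_iff.2 (sub_ne_zero.2 h)
  rw [kernel, ← ofReal_norm, ENNReal.ofReal_rpow_of_pos this]

/-- Integral over space in polar coordinates. -/
theorem lintegral_polar (hN : 2 ≤ N) {f : Eu N → ℝ≥0∞} (hf : Measurable f) :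
    ∫⁻ x, f x = ∫⁻ e, (∫⁻ t in Set.Ioi (0 : ℝ), ENNReal.ofReal (t ^ (N - 1)) * f (t • (e : Eu N)))
      ∂(volume : Measure (Eu N)).toSphere := by
  have hN' : Nontrivial (Eu N) := by
    have : Nonempty (Fin N) := ⟨⟨0, by omega⟩⟩
    infer_instance
  have h := (volume : Measure (Eu N)).measurePreserving_homeomorphUnitSphereProd
  rw [finrank_euclideanSpace_fin] at h
  have hg : Measurable (fun p : sphere (0 : Eu N) 1 × Set.Ioi (0 : ℝ) =>
      f ((p.2 : ℝ) • (p.1 : Eu N))) := by fun_prop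
  have h1 := h.lintegral_comp hg
  have h2 : ∫⁻ x, f x = ∫⁻ x : ({(0 : Eu N)}ᶜ : Set (Eu N)), f x
      ∂((volume : Measure (Eu N)).comap (↑)) := by
    rw [lintegral_subtype_comap (measurableSet_singleton _).compl f, restrict_compl_singleton]
  rw [h2]
  have h3 : ∀ x : ({(0 : Eu N)}ᶜ : Set (Eu N)),
      f (((homeomorphUnitSphereProd (Eu N) x).2 : ℝ) • ((homeomorphUnitSphereProd (Eu N) x).1 : Eu N))
        = f x := by
    intro x
    congr 1
    have := (homeomorphUnitSphereProd (Eu N)).symm_apply_apply x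
    have h4 := congrArg Subtype.val this
    rwa [homeomorphUnitSphereProd_symm_apply_coe] at h4
  simp only [h3] at h1
  rw [h1, lintegral_prod _ hg.aemeasurable]
  refine lintegral_congr fun e => ?_
  rw [Measure.volumeIoiPow, lintegral_withDensity_eq_lintegral_mul _ (by fun_prop) (by fun_prop)]
  simp only [Pi.mul_apply]
  exact lintegral_subtype_comap measurableSet_Ioi
    (fun r : ℝ => ENNReal.ofReal (r ^ (N - 1)) * f (r • (e : Eu N)))

theorem lintegral_ball_kernel_lt_top (hN : 2 ≤ N) {a : ℝ} (ha : a < N) :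
    ∫⁻ y in ball (0 : Eu N) 1, ‖y‖ₑ ^ (-a) < ⊤ := by
  have hN' : Nontrivial (Eu N) := by
    have : Nonempty (Fin N) := ⟨⟨0, by omega⟩⟩
    infer_instance
  have h : IntegrableOn (fun x : Eu N => ‖x‖ ^ (-a)) (ball (0 : Eu N) 1) volume := by
    rw [integrableOn_fun_norm_addHaar volume (f := fun r => r ^ (-a)), finrank_euclideanSpace_fin]
    have h1 : IntegrableOn (fun y : ℝ => y ^ ((N : ℝ) - 1 - a)) (Set.Ioo 0 1) := by
      rw [intervalIntegral.integrableOn_Ioo_rpow_iff one_pos]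
      linarith
    refine h1.congr_fun (fun y hy => ?_) measurableSet_Ioo
    have h2 : ((N : ℝ) - 1) = ((N - 1 : ℕ) : ℝ) := by
      rw [Nat.cast_sub (by omega)]; simp
    change y ^ ((N : ℝ) - 1 - a) = _
    rw [sub_eq_add_neg, Real.rpow_add hy.1, h2, Real.rpow_natCast, smul_eq_mul]
  have h3 := h.2
  rw [HasFiniteIntegral] at h3
  refine lt_of_le_of_lt (lintegral_mono_ae ?_) h3
  have : ∀ᵐ x : Eu N, x ≠ 0 := by
    simp [ae_iff, measure_singleton]
  filter_upwards [ae_restrict_of_ae this] with x hx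
  have hpos : 0 < ‖x‖ := norm_pos_iff.2 hx
  rw [← ofReal_norm, ENNReal.ofReal_rpow_of_pos hpos,
    Real.enorm_eq_ofReal (Real.rpow_nonneg hpos.le _)]

theorem enorm_rpow_neg_le_one {a : ℝ} (ha : 0 < a) {x : Eu N} (hx : 1 ≤ ‖x‖) :
    ‖x‖ₑ ^ (-a) ≤ 1 := by
  rw [ENNReal.rpow_neg]
  refine ENNReal.inv_le_one.2 (ENNReal.one_le_rpow ?_ ?_)
  · rw [← ofReal_norm]; exact ENNReal.one_le_ofReal.2 hx
  · exact ha

theorem setLIntegral_kernel_eq (a : ℝ) (E : Set (Eu N)) (x : Eu N) :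
    ∫⁻ y in E, kernel a x y = ∫⁻ y in (fun y => x - y) ⁻¹' E, ‖y‖ₑ ^ (-a) := by
  have h := ((volume : Measure (Eu N)).measurePreserving_sub_left x).setLIntegral_comp_emb
    (MeasurableEquiv.subLeft x).measurableEmbedding (kernel a x) ((fun y => x - y) ⁻¹' E)
  have h2 : (fun y => x - y) '' ((fun y => x - y) ⁻¹' E) = E :=
    Set.image_preimage_eq E (fun y => ⟨x - y, by simp⟩)
  rw [h2] at h
  rw [← h]
  simp [kernel]

/-- Potentials of small sets are uniformly small. -/
theorem exists_potential_small (hN : 2 ≤ N) {a : ℝ} (ha0 : 0 < a) (ha : a < N) {η : ℝ≥0∞}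
    (hη : 0 < η) :
    ∃ m : ℝ≥0∞, 0 < m ∧ ∀ E : Set (Eu N), volume E < m → ∀ x, ∫⁻ y in E, kernel a x y ≤ η := by
  have h2 : 0 < η / 2 := ENNReal.half_pos hη.ne'
  obtain ⟨δ, hδ, h⟩ := exists_pos_setLIntegral_lt_of_measure_lt
    (lintegral_ball_kernel_lt_top hN ha).ne h2.ne'
  refine ⟨min δ (η / 2), lt_min hδ h2, fun E hE x => ?_⟩
  rw [setLIntegral_kernel_eq]
  set F := (fun y => x - y) ⁻¹' E
  have hF : volume F = volume E :=
    ((volume : Measure (Eu N)).measurePreserving_sub_left x).measure_preimage_emb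
    (MeasurableEquiv.subLeft x).measurableEmbedding E
  have hsub : F ⊆ (F ∩ ball 0 1) ∪ (F \ ball 0 1) := by rw [Set.inter_union_sdiff]
  refine (lintegral_mono_set hsub).trans ((lintegral_union_le _ _ _).trans ?_)
  rw [← ENNReal.add_halves η]
  refine add_le_add ?_ ?_
  · have := h F
    rw [Measure.restrict_restrict' measurableSet_ball] at this
    refine (this ?_).le
    refine (Measure.restrict_apply_le _ _).trans_lt ?_
    rw [hF]
    exact hE.trans_le (min_le_left _ _)
  · calc ∫⁻ y in F \ ball 0 1, ‖y‖ₑ ^ (-a) ≤ ∫⁻ y in F \ ball 0 1, 1 := by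
          refine setLIntegral_mono measurable_const fun y hy => enorm_rpow_neg_le_one ha0 ?_
          simpa using hy.2
      _ ≤ η / 2 := by
          rw [setLIntegral_one]
          exact (measure_mono Set.sdiff_subset).trans (hF ▸ (hE.trans_le (min_le_right _ _)).le)

/-- The Riesz potential of the indicator of `E`. -/
noncomputable def potential (a : ℝ) (E : Set (Eu N)) (x : Eu N) : ℝ≥0∞ := ∫⁻ y in E, kernel a x y

/-- The Riesz energy of `E` with values in `[0, ∞]`. -/
noncomputable def energy (a : ℝ) (E : Set (Eu N)) : ℝ≥0∞ := ∫⁻ x in E, potential a E x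

theorem measurable_potential (a : ℝ) (E : Set (Eu N)) : Measurable (potential a E) :=
  (measurable_kernel a).lintegral_prod_right'

theorem potential_union_le (a : ℝ) (E G : Set (Eu N)) (x : Eu N) :
    potential a (E ∪ G) x ≤ potential a E x + potential a G x :=
  lintegral_union_le _ _ _

theorem potential_mono (a : ℝ) {E G : Set (Eu N)} (h : E ⊆ G) (x : Eu N) :
    potential a E x ≤ potential a G x :=
  lintegral_mono_set h

theorem lintegral_potential_comm (a : ℝ) (E G : Set (Eu N)) :
    ∫⁻ x in E, potential a G x = ∫⁻ x in G, potential a E x := by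
  unfold potential
  rw [lintegral_lintegral_swap (measurable_kernel a).aemeasurable]
  simp only [kernel_comm]

theorem potential_le (hN : 2 ≤ N) {a : ℝ} (ha0 : 0 < a) (ha : a < N) :
    ∃ M : ℝ≥0∞, M < ⊤ ∧ ∀ (E : Set (Eu N)) (x : Eu N), potential a E x ≤ M + volume E := by
  refine ⟨_, lintegral_ball_kernel_lt_top hN ha, fun E x => ?_⟩
  rw [potential, setLIntegral_kernel_eq]
  set F := (fun y => x - y) ⁻¹' E
  have hF : volume F = volume E :=
    ((volume : Measure (Eu N)).measurePreserving_sub_left x).measure_preimage_emb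
    (MeasurableEquiv.subLeft x).measurableEmbedding E
  have hsub : F ⊆ ball 0 1 ∪ (F \ ball 0 1) := by
    rw [Set.union_sdiff_self]; exact Set.subset_union_right
  refine (lintegral_mono_set hsub).trans ((lintegral_union_le _ _ _).trans ?_)
  refine add_le_add le_rfl ?_
  calc ∫⁻ y in F \ ball 0 1, ‖y‖ₑ ^ (-a) ≤ ∫⁻ y in F \ ball 0 1, 1 := by
        refine setLIntegral_mono measurable_const fun y hy => enorm_rpow_neg_le_one ha0 ?_
        simpa using hy.2
    _ ≤ volume E := by
        rw [setLIntegral_one]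
        exact (measure_mono Set.sdiff_subset).trans hF.le

theorem potential_lt_top (hN : 2 ≤ N) {a : ℝ} (ha0 : 0 < a) (ha : a < N) {E : Set (Eu N)}
    (hE : volume E < ⊤) (x : Eu N) : potential a E x < ⊤ := by
  obtain ⟨M, hM, h⟩ := potential_le hN ha0 ha
  exact (h E x).trans_lt (ENNReal.add_lt_top.2 ⟨hM, hE⟩)

theorem energy_lt_top (hN : 2 ≤ N) {a : ℝ} (ha0 : 0 < a) (ha : a < N) {E : Set (Eu N)}
    (hE : volume E < ⊤) : energy a E < ⊤ := by
  obtain ⟨M, hM, h⟩ := potential_le hN ha0 ha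
  calc energy a E ≤ ∫⁻ x in E, (M + volume E) := lintegral_mono fun x => h E x
    _ < ⊤ := by
      rw [setLIntegral_const]
      exact ENNReal.mul_lt_top (ENNReal.add_lt_top.2 ⟨hM, hE⟩) hE

theorem exists_energy_le_add (hN : 2 ≤ N) {a : ℝ} (ha0 : 0 < a) (ha : a < N) {v : ℝ≥0∞}
    (hv : v < ⊤) :
    ∃ M : ℝ≥0∞, M < ⊤ ∧ ∀ E G : Set (Eu N), volume E ≤ v → volume G ≤ v →
      energy a E ≤ energy a G + M * volume (E \ G) := by
  obtain ⟨M, hM, h⟩ := potential_le hN ha0 ha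
  refine ⟨2 * (M + v), ENNReal.mul_lt_top (by simp) (ENNReal.add_lt_top.2 ⟨hM, hv⟩),
    fun E G hE hG => ?_⟩
  have hsub : E ⊆ G ∪ (E \ G) := by
    rw [Set.union_sdiff_self]; exact Set.subset_union_right
  have hb : ∀ F : Set (Eu N), volume F ≤ v →
      ∫⁻ x in E \ G, potential a F x ≤ (M + v) * volume (E \ G) := by
    intro F hF
    rw [← setLIntegral_const]
    exact lintegral_mono fun x => (h F x).trans (by gcongr)
  calc energy a E ≤ ∫⁻ x in G ∪ (E \ G), potential a E x := lintegral_mono_set hsub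
    _ ≤ (∫⁻ x in G, potential a E x) + ∫⁻ x in E \ G, potential a E x := lintegral_union_le _ _ _
    _ ≤ (∫⁻ x in G, (potential a G x + potential a (E \ G) x))
        + ∫⁻ x in E \ G, potential a E x := by
      gcongr with x
      exact (potential_mono a hsub x).trans (potential_union_le a _ _ x)
    _ = energy a G + (∫⁻ x in E \ G, potential a G x) + ∫⁻ x in E \ G, potential a E x := by
      rw [lintegral_add_left (measurable_potential a G), lintegral_potential_comm a G (E \ G)]; rfl
    _ ≤ energy a G + (M + v) * volume (E \ G) + (M + v) * volume (E \ G) := by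
      gcongr
      · exact hb G hG
      · exact hb E hE
    _ = energy a G + 2 * (M + v) * volume (E \ G) := by ring

theorem rieszEnergy_eq_toReal (hN : 2 ≤ N) {α : ℝ} (hα0 : 0 < α) (hα : α < N) {E : Set (Eu N)}
    (hE : volume E < ⊤) : rieszEnergy N α E = (energy (N - α) E).toReal := by
  have ha0 : 0 < (N : ℝ) - α := by linarith
  have ha : (N : ℝ) - α < N := by linarith
  have hin : ∀ x : Eu N, ∫ y in E, ‖y - x‖ ^ (α - (N : ℝ)) = (potential (N - α) E x).toReal := by
    intro x
    rw [integral_eq_lintegral_of_nonneg_ae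
      (Filter.Eventually.of_forall fun y => Real.rpow_nonneg (norm_nonneg _) _)
      ((Measurable.pow_const (by fun_prop) _).aestronglyMeasurable), potential]
    congr 1
    refine lintegral_congr_ae ?_
    have : ∀ᵐ y : Eu N, y ≠ x := by
      have : Nontrivial (Eu N) := by
        have : Nonempty (Fin N) := ⟨⟨0, by omega⟩⟩
        infer_instance
      simp [ae_iff, measure_singleton]
    filter_upwards [ae_restrict_of_ae this] with y hy
    rw [kernel_comm, kernel_eq_ofReal hy, neg_sub]
  unfold rieszEnergy energy
  simp only [hin]
  exact integral_toReal (measurable_potential _ _).aemeasurable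
    (Filter.Eventually.of_forall fun x => potential_lt_top hN ha0 ha hE x)

/-- Reflection across the hyperplane `{x | ⟪x, e⟫ = s}`, for a unit vector `e`. -/
noncomputable def refl (e : Eu N) (s : ℝ) (x : Eu N) : Eu N := x - (2 * (⟪x, e⟫ - s)) • e

theorem continuous_refl_uncurry : Continuous (fun p : Eu N × ℝ × Eu N => refl p.1 p.2.1 p.2.2) := by
  unfold refl
  fun_prop

theorem continuous_refl (e : Eu N) (s : ℝ) : Continuous (refl e s) := by
  unfold refl
  fun_prop

theorem measurable_refl (e : Eu N) (s : ℝ) : Measurable (refl e s) :=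
  (continuous_refl e s).measurable

theorem inner_refl {e : Eu N} (he : ‖e‖ = 1) (s : ℝ) (x : Eu N) :
    ⟪refl e s x, e⟫ = 2 * s - ⟪x, e⟫ := by
  rw [refl, inner_sub_left, inner_smul_left, real_inner_self_eq_norm_sq, he]
  simp
  ring

theorem refl_refl {e : Eu N} (he : ‖e‖ = 1) (s : ℝ) (x : Eu N) : refl e s (refl e s x) = x := by
  rw [refl, inner_refl he, refl, sub_sub, ← add_smul]
  simp
  left
  ring

theorem norm_sq_sub_refl {e : Eu N} (he : ‖e‖ = 1) (s : ℝ) (x y : Eu N) :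
    ‖x - refl e s y‖ ^ 2 = ‖x - y‖ ^ 2 + 4 * (⟪x, e⟫ - s) * (⟪y, e⟫ - s) := by
  have : x - refl e s y = (x - y) + (2 * (⟪y, e⟫ - s)) • e := by
    rw [refl]; abel
  rw [this, norm_add_sq_real, inner_smul_right, inner_sub_left, norm_smul, he]
  simp only [Real.norm_eq_abs, mul_one, sq_abs]
  ring

theorem norm_refl_sub_refl {e : Eu N} (he : ‖e‖ = 1) (s : ℝ) (x y : Eu N) :
    ‖refl e s x - refl e s y‖ = ‖x - y‖ := by
  have h := norm_sq_sub_refl he s (refl e s x) y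
  rw [norm_sub_rev _ y, norm_sq_sub_refl he s y x, inner_refl he, norm_sub_rev y x] at h
  refine (pow_left_inj₀ (norm_nonneg _) (norm_nonneg _) two_ne_zero).1 ?_
  rw [h]; ring

theorem norm_sq_refl {e : Eu N} (he : ‖e‖ = 1) (s : ℝ) (x : Eu N) :
    ‖refl e s x‖ ^ 2 = ‖x‖ ^ 2 - 4 * s * (⟪x, e⟫ - s) := by
  have h := norm_sq_sub_refl he s 0 x
  simp only [zero_sub, norm_neg, inner_zero_left] at h
  rw [h]; ring

theorem norm_sub_refl_comm {e : Eu N} (he : ‖e‖ = 1) (s : ℝ) (x y : Eu N) :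
    ‖x - refl e s y‖ = ‖refl e s x - y‖ := by
  rw [← norm_refl_sub_refl he s x, refl_refl he]

theorem measurePreserving_refl {e : Eu N} (he : ‖e‖ = 1) (s : ℝ) :
    MeasurePreserving (refl e s) (volume : Measure (Eu N)) volume := by
  have h1 := ((Submodule.reflection (ℝ ∙ e)ᗮ)).measurePreserving
  have h2 := measurePreserving_add_right (volume : Measure (Eu N)) ((2 * s) • e)
  have h3 := h2.comp h1
  have h4 : refl e s = (fun x => x + (2 * s) • e) ∘ (Submodule.reflection (ℝ ∙ e)ᗮ) := by
    ext1 x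
    rw [Function.comp_apply, Submodule.reflection_orthogonal_apply,
      Submodule.reflection_singleton_apply, he, refl, real_inner_comm]
    simp only [RCLike.ofReal_real_eq_id, id, one_pow, div_one]
    module
  rw [h4]
  exact h3

theorem kernel_refl_refl {e : Eu N} (he : ‖e‖ = 1) (s : ℝ) (a : ℝ) (x y : Eu N) :
    kernel a (refl e s x) (refl e s y) = kernel a x y := by
  rw [kernel, kernel, ← ofReal_norm, norm_refl_sub_refl he, ofReal_norm]

theorem kernel_refl_comm {e : Eu N} (he : ‖e‖ = 1) (s : ℝ) (a : ℝ) (x y : Eu N) :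
    kernel a x (refl e s y) = kernel a (refl e s x) y := by
  rw [kernel, kernel, ← ofReal_norm, norm_sub_refl_comm he, ofReal_norm]

theorem kernel_anti {a : ℝ} (ha : 0 ≤ a) {x y x' y' : Eu N} (h : ‖x - y‖ ≤ ‖x' - y'‖) :
    kernel a x' y' ≤ kernel a x y := by
  unfold kernel
  rw [ENNReal.rpow_neg, ENNReal.rpow_neg]
  refine ENNReal.inv_le_inv.2 (ENNReal.rpow_le_rpow ?_ ha)
  rw [← ofReal_norm, ← ofReal_norm]
  exact ENNReal.ofReal_le_ofReal h

theorem kernel_strict_anti {a : ℝ} (ha : 0 < a) {x y x' y' : Eu N} (h : ‖x - y‖ < ‖x' - y'‖) :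
    kernel a x' y' < kernel a x y := by
  unfold kernel
  rw [ENNReal.rpow_neg, ENNReal.rpow_neg]
  refine ENNReal.inv_lt_inv.2 (ENNReal.rpow_lt_rpow ?_ ha)
  rw [← ofReal_norm, ← ofReal_norm]
  exact (ENNReal.ofReal_lt_ofReal_iff ((norm_nonneg _).trans_lt h)).2 h

theorem kernel_refl_le {a : ℝ} (ha : 0 ≤ a) {e : Eu N} (he : ‖e‖ = 1) (s : ℝ) {x y : Eu N}
    (h : 0 ≤ (⟪x, e⟫ - s) * (⟪y, e⟫ - s)) : kernel a x (refl e s y) ≤ kernel a x y := by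
  refine kernel_anti ha ((pow_le_pow_iff_left₀ (norm_nonneg _) (norm_nonneg _) two_ne_zero).1 ?_)
  rw [norm_sq_sub_refl he]; linarith

theorem kernel_le_refl {a : ℝ} (ha : 0 ≤ a) {e : Eu N} (he : ‖e‖ = 1) (s : ℝ) {x y : Eu N}
    (h : (⟪x, e⟫ - s) * (⟪y, e⟫ - s) ≤ 0) : kernel a x y ≤ kernel a x (refl e s y) := by
  refine kernel_anti ha ((pow_le_pow_iff_left₀ (norm_nonneg _) (norm_nonneg _) two_ne_zero).1 ?_)
  rw [norm_sq_sub_refl he]; linarith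

theorem kernel_refl_lt {a : ℝ} (ha : 0 < a) {e : Eu N} (he : ‖e‖ = 1) (s : ℝ) {x y : Eu N}
    (h : 0 < (⟪x, e⟫ - s) * (⟪y, e⟫ - s)) : kernel a x (refl e s y) < kernel a x y := by
  refine kernel_strict_anti ha
    ((pow_lt_pow_iff_left₀ (norm_nonneg _) (norm_nonneg _) two_ne_zero).1 ?_)
  rw [norm_sq_sub_refl he]; linarith

/-- The polarization of `E` towards the half-space `{x | ⟪x, e⟫ < s}`. -/
def polarize (e : Eu N) (s : ℝ) (E : Set (Eu N)) : Set (Eu N) :=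
  {x | (⟪x, e⟫ < s ∧ (x ∈ E ∨ refl e s x ∈ E)) ∨ (s ≤ ⟪x, e⟫ ∧ x ∈ E ∧ refl e s x ∈ E)}

/-- The points of the half-space missing from `E` whose mirror images lie in `E`. -/
def gained (e : Eu N) (s : ℝ) (E : Set (Eu N)) : Set (Eu N) :=
  {x | ⟪x, e⟫ < s ∧ x ∉ E ∧ refl e s x ∈ E}

/-- The points of the half-space lying in `E` whose mirror images do not lie in `E`. -/
def dominant (e : Eu N) (s : ℝ) (E : Set (Eu N)) : Set (Eu N) :=
  {x | ⟪x, e⟫ < s ∧ x ∈ E ∧ refl e s x ∉ E}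

theorem measurableSet_halfspace (e : Eu N) (s : ℝ) : MeasurableSet {x : Eu N | ⟪x, e⟫ < s} :=
  measurableSet_lt (by fun_prop) measurable_const

theorem measurableSet_polarize (e : Eu N) (s : ℝ) {E : Set (Eu N)} (hE : MeasurableSet E) :
    MeasurableSet (polarize e s E) := by
  have h1 := measurableSet_halfspace e s
  have h2 : MeasurableSet {x : Eu N | s ≤ ⟪x, e⟫} := measurableSet_le measurable_const (by fun_prop)
  have h3 : MeasurableSet {x | refl e s x ∈ E} := measurable_refl e s hE
  exact (h1.inter (hE.union h3)).union (h2.inter (hE.inter h3))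

theorem measurableSet_gained (e : Eu N) (s : ℝ) {E : Set (Eu N)} (hE : MeasurableSet E) :
    MeasurableSet (gained e s E) :=
  (measurableSet_halfspace e s).inter (hE.compl.inter (measurable_refl e s hE))

theorem measurableSet_dominant (e : Eu N) (s : ℝ) {E : Set (Eu N)} (hE : MeasurableSet E) :
    MeasurableSet (dominant e s E) :=
  (measurableSet_halfspace e s).inter (hE.inter (measurable_refl e s hE.compl))

theorem refl_of_inner_eq {e : Eu N} {s : ℝ} {x : Eu N} (h : ⟪x, e⟫ = s) : refl e s x = x := by
  simp [refl, h]

/-- Averaging an integral over a reflection. -/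
theorem two_mul_lintegral {e : Eu N} (he : ‖e‖ = 1) (s : ℝ) {f : Eu N → ℝ≥0∞} (hf : Measurable f) :
    2 * ∫⁻ x, f x = ∫⁻ x, (f x + f (refl e s x)) := by
  rw [lintegral_add_left hf, (measurePreserving_refl he s).lintegral_comp hf, two_mul]

/-- The indicator of a set with values in `[0, ∞]`. -/
noncomputable def ind (E : Set (Eu N)) (x : Eu N) : ℝ≥0∞ := E.indicator 1 x

theorem ind_of_mem {E : Set (Eu N)} {x : Eu N} (h : x ∈ E) : ind E x = 1 := by simp [ind, h]

theorem ind_of_notMem {E : Set (Eu N)} {x : Eu N} (h : x ∉ E) : ind E x = 0 := by simp [ind, h]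

open Classical in
theorem ind_eq_ite (E : Set (Eu N)) (x : Eu N) : ind E x = if x ∈ E then 1 else 0 := by
  split_ifs with h
  · exact ind_of_mem h
  · exact ind_of_notMem h

theorem measurable_ind {E : Set (Eu N)} (hE : MeasurableSet E) : Measurable (ind E) :=
  measurable_one.indicator hE

theorem lintegral_ind {E : Set (Eu N)} (hE : MeasurableSet E) : ∫⁻ x, ind E x = volume E :=
  lintegral_indicator_one hE

theorem two_mul_measure {e : Eu N} (he : ‖e‖ = 1) (s : ℝ) {E : Set (Eu N)} (hE : MeasurableSet E) :
    2 * volume E = ∫⁻ x, (ind E x + ind E (refl e s x)) := by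
  rw [← lintegral_ind hE, two_mul_lintegral he s (measurable_ind hE)]

theorem mem_polarize_of_le {e : Eu N} (he : ‖e‖ = 1) {s : ℝ} (E : Set (Eu N)) {x : Eu N}
    (h : ⟪x, e⟫ ≤ s) : (x ∈ polarize e s E ↔ x ∈ E ∨ refl e s x ∈ E) ∧
      (refl e s x ∈ polarize e s E ↔ x ∈ E ∧ refl e s x ∈ E) := by
  simp only [polarize, Set.mem_ofPred_eq, inner_refl he, refl_refl he]
  rcases h.lt_or_eq with h | h
  · have h1 : ¬ 2 * s - ⟪x, e⟫ < s := by linarith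
    have h2 : s ≤ 2 * s - ⟪x, e⟫ := by linarith
    have h3 : ¬ s ≤ ⟪x, e⟫ := by linarith
    simp only [h, h1, h2, h3]
    tauto
  · rw [refl_of_inner_eq h]
    have h1 : ¬ 2 * s - ⟪x, e⟫ < s := by linarith
    have h2 : s ≤ 2 * s - ⟪x, e⟫ := by linarith
    have h3 : s ≤ ⟪x, e⟫ := by linarith
    have h4 : ¬ ⟪x, e⟫ < s := by linarith
    simp only [h1, h2, h3, h4]
    tauto

theorem mem_polarize_of_ge {e : Eu N} (he : ‖e‖ = 1) {s : ℝ} (E : Set (Eu N)) {x : Eu N}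
    (h : s ≤ ⟪x, e⟫) : (x ∈ polarize e s E ↔ x ∈ E ∧ refl e s x ∈ E) ∧
      (refl e s x ∈ polarize e s E ↔ x ∈ E ∨ refl e s x ∈ E) := by
  have h1 : ⟪refl e s x, e⟫ ≤ s := by rw [inner_refl he]; linarith
  have h2 := mem_polarize_of_le he E h1
  rw [refl_refl he] at h2
  exact ⟨by rw [h2.2, and_comm], by rw [h2.1, or_comm]⟩

theorem volume_polarize {e : Eu N} (he : ‖e‖ = 1) (s : ℝ) {E : Set (Eu N)} (hE : MeasurableSet E) :
    volume (polarize e s E) = volume E := by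
  have h : 2 * volume (polarize e s E) = 2 * volume E := by
    rw [two_mul_measure he s hE, two_mul_measure he s (measurableSet_polarize e s hE)]
    refine lintegral_congr fun x => ?_
    rcases le_total (⟪x, e⟫) s with h | h
    · have := mem_polarize_of_le he E h
      by_cases hx : x ∈ E <;> by_cases hy : refl e s x ∈ E <;> simp [ind, this, hx, hy]
    · have := mem_polarize_of_ge he E h
      by_cases hx : x ∈ E <;> by_cases hy : refl e s x ∈ E <;> simp [ind, this, hx, hy]
  exact (ENNReal.mul_right_inj (by simp) (by simp)).1 h

theorem polarize_subset_ball {e : Eu N} (he : ‖e‖ = 1) {s : ℝ} (hs : 0 ≤ s) {E : Set (Eu N)} {r : ℝ}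
    (h : E ⊆ ball 0 r) : polarize e s E ⊆ ball 0 r := by
  rintro x (⟨h1, h2 | h2⟩ | ⟨h1, h2, h3⟩)
  · exact h h2
  · have h3 := h h2
    rw [mem_ball_zero_iff] at h3 ⊢
    refine lt_of_le_of_lt ?_ h3
    refine (pow_le_pow_iff_left₀ (norm_nonneg _) (norm_nonneg _) two_ne_zero).1 ?_
    rw [norm_sq_refl he]
    nlinarith
  · exact h h2

theorem ball_subset_polarize {e : Eu N} (he : ‖e‖ = 1) {s : ℝ} (hs : 0 ≤ s) {E : Set (Eu N)} {r : ℝ}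
    (h : ball 0 r ⊆ E) : ball 0 r ⊆ polarize e s E := by
  intro x hx
  rcases lt_or_ge (⟪x, e⟫) s with h1 | h1
  · exact Or.inl ⟨h1, Or.inl (h hx)⟩
  · refine Or.inr ⟨h1, h hx, h ?_⟩
    rw [mem_ball_zero_iff] at hx ⊢
    refine lt_of_le_of_lt ?_ hx
    refine (pow_le_pow_iff_left₀ (norm_nonneg _) (norm_nonneg _) two_ne_zero).1 ?_
    rw [norm_sq_refl he]
    nlinarith

/-- Interaction of the four pairs obtained from `(x, y)` by reflecting each entry. -/
noncomputable def interaction (a : ℝ) (e : Eu N) (s : ℝ) (E : Set (Eu N)) (p : Eu N × Eu N) :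
    ℝ≥0∞ :=
  (ind E p.1 * ind E p.2 + ind E (refl e s p.1) * ind E (refl e s p.2)) * kernel a p.1 p.2 +
  (ind E p.1 * ind E (refl e s p.2) + ind E (refl e s p.1) * ind E p.2) *
    kernel a p.1 (refl e s p.2)

theorem energy_eq_prod (a : ℝ) {E : Set (Eu N)} (hE : MeasurableSet E) :
    energy a E = ∫⁻ p : Eu N × Eu N, ind E p.1 * ind E p.2 * kernel a p.1 p.2 := by
  have hm := measurable_ind hE
  have hk := measurable_kernel (N := N) a
  rw [Measure.volume_eq_prod, lintegral_prod _ (by fun_prop), energy, ← lintegral_indicator hE]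
  refine lintegral_congr fun x => ?_
  by_cases hx : x ∈ E
  · rw [Set.indicator_of_mem hx, potential, ← lintegral_indicator hE]
    refine lintegral_congr fun y => ?_
    by_cases hy : y ∈ E <;> simp [ind, hx, hy]
  · simp [ind, hx]

theorem measurable_interaction (a : ℝ) (e : Eu N) (s : ℝ) {E : Set (Eu N)} (hE : MeasurableSet E) :
    Measurable fun p => interaction a e s E p := by
  have hm := measurable_ind hE
  have hk := measurable_kernel (N := N) a
  have hr := measurable_refl e s
  have hk2 : Measurable fun p : Eu N × Eu N => kernel a p.1 (refl e s p.2) := by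
    have hp : Measurable fun p : Eu N × Eu N => (p.1, refl e s p.2) := by fun_prop
    have h := hk.comp hp
    simp only [Function.comp_def] at h
    exact h
  have m1 : Measurable fun p : Eu N × Eu N => ind E p.1 := hm.comp measurable_fst
  have m2 : Measurable fun p : Eu N × Eu N => ind E p.2 := hm.comp measurable_snd
  have m3 : Measurable fun p : Eu N × Eu N => ind E (refl e s p.1) := (hm.comp hr).comp measurable_fst
  have m4 : Measurable fun p : Eu N × Eu N => ind E (refl e s p.2) := (hm.comp hr).comp measurable_snd
  unfold interaction
  refine Measurable.add (Measurable.mul (Measurable.add ?_ ?_) hk)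
    (Measurable.mul (Measurable.add ?_ ?_) hk2)
  · exact m1.mul m2
  · exact m3.mul m4
  · exact m1.mul m4
  · exact m3.mul m2

theorem four_mul_energy (a : ℝ) {e : Eu N} (he : ‖e‖ = 1) (s : ℝ) {E : Set (Eu N)}
    (hE : MeasurableSet E) : 4 * energy a E = ∫⁻ p : Eu N × Eu N, interaction a e s E p := by
  have hm := measurable_ind hE
  have hk := measurable_kernel (N := N) a
  have hr := measurable_refl e s
  have hσ := measurePreserving_refl he s
  have hi := MeasurePreserving.id (volume : Measure (Eu N))
  have hf : Measurable fun p : Eu N × Eu N => ind E p.1 * ind E p.2 * kernel a p.1 p.2 := by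
    fun_prop
  have h1 := (hσ.prod hσ).lintegral_comp hf
  have h2 := (hi.prod hσ).lintegral_comp hf
  have h3 := (hσ.prod hi).lintegral_comp hf
  simp only [← Measure.volume_eq_prod, ← energy_eq_prod a hE, Prod.map, id] at h1 h2 h3
  have h0 := energy_eq_prod a hE
  have hm1 : Measurable fun p : Eu N × Eu N => ind E (refl e s p.1) * ind E (refl e s p.2) *
      kernel a (refl e s p.1) (refl e s p.2) := hf.comp (hσ.prod hσ).measurable
  have hm2 : Measurable fun p : Eu N × Eu N => ind E p.1 * ind E (refl e s p.2) *
      kernel a p.1 (refl e s p.2) := hf.comp (hi.prod hσ).measurable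
  have hm3 : Measurable fun p : Eu N × Eu N => ind E (refl e s p.1) * ind E p.2 *
      kernel a (refl e s p.1) p.2 := hf.comp (hσ.prod hi).measurable
  have : 4 * energy a E = energy a E + energy a E + energy a E + energy a E := by ring
  rw [this]
  nth_rewrite 1 [h0]
  nth_rewrite 1 [← h1]
  nth_rewrite 1 [← h2]
  nth_rewrite 1 [← h3]
  rw [← lintegral_add_right _ hm1, ← lintegral_add_right _ hm2, ← lintegral_add_right _ hm3]
  refine lintegral_congr fun p => ?_
  simp only [interaction, kernel_refl_refl he, kernel_refl_comm he]
  ring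

theorem interaction_le_polarize {a : ℝ} (ha : 0 ≤ a) {e : Eu N} (he : ‖e‖ = 1) (s : ℝ)
    (E : Set (Eu N)) (p : Eu N × Eu N) :
    interaction a e s E p ≤ interaction a e s (polarize e s E) p := by
  obtain ⟨x, y⟩ := p
  rcases le_total (⟪x, e⟫) s with hx | hx <;> rcases le_total (⟪y, e⟫) s with hy | hy
  · have h1 := mem_polarize_of_le he E hx
    have h2 := mem_polarize_of_le he E hy
    have hk := kernel_refl_le ha he s (x := x) (y := y)
      (mul_nonneg_of_nonpos_of_nonpos (by linarith) (by linarith))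
    by_cases a1 : x ∈ E <;> by_cases a2 : refl e s x ∈ E <;> by_cases a3 : y ∈ E <;>
      by_cases a4 : refl e s y ∈ E <;> simp [interaction, ind, h1, h2, a1, a2, a3, a4, hk]
  · have h1 := mem_polarize_of_le he E hx
    have h2 := mem_polarize_of_ge he E hy
    have hk := kernel_le_refl ha he s (x := x) (y := y)
      (mul_nonpos_of_nonpos_of_nonneg (by linarith) (by linarith))
    by_cases a1 : x ∈ E <;> by_cases a2 : refl e s x ∈ E <;> by_cases a3 : y ∈ E <;>
      by_cases a4 : refl e s y ∈ E <;> simp [interaction, ind, h1, h2, a1, a2, a3, a4, hk]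
  · have h1 := mem_polarize_of_ge he E hx
    have h2 := mem_polarize_of_le he E hy
    have hk := kernel_le_refl ha he s (x := x) (y := y)
      (mul_nonpos_of_nonneg_of_nonpos (by linarith) (by linarith))
    by_cases a1 : x ∈ E <;> by_cases a2 : refl e s x ∈ E <;> by_cases a3 : y ∈ E <;>
      by_cases a4 : refl e s y ∈ E <;> simp [interaction, ind, h1, h2, a1, a2, a3, a4, hk]
  · have h1 := mem_polarize_of_ge he E hx
    have h2 := mem_polarize_of_ge he E hy
    have hk := kernel_refl_le ha he s (x := x) (y := y)
      (mul_nonneg (by linarith) (by linarith))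
    by_cases a1 : x ∈ E <;> by_cases a2 : refl e s x ∈ E <;> by_cases a3 : y ∈ E <;>
      by_cases a4 : refl e s y ∈ E <;> simp [interaction, ind, h1, h2, a1, a2, a3, a4, hk]

theorem energy_le_polarize {a : ℝ} (ha : 0 ≤ a) {e : Eu N} (he : ‖e‖ = 1) (s : ℝ)
    {E : Set (Eu N)} (hE : MeasurableSet E) : energy a E ≤ energy a (polarize e s E) := by
  have h : 4 * energy a E ≤ 4 * energy a (polarize e s E) := by
    rw [four_mul_energy a he s hE, four_mul_energy a he s (measurableSet_polarize e s hE)]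
    exact lintegral_mono fun p => interaction_le_polarize ha he s E p
  exact (ENNReal.mul_le_mul_iff_right (by simp) (by simp)).1 h

theorem energy_lt_polarize (hN : 2 ≤ N) {a : ℝ} (ha : 0 < a) (haN : a < N) {e : Eu N} (he : ‖e‖ = 1)
    (s : ℝ) {E : Set (Eu N)} (hE : MeasurableSet E) (hv : volume E < ⊤)
    (hg : 0 < volume (gained e s E)) (hd : 0 < volume (dominant e s E)) :
    energy a E < energy a (polarize e s E) := by
  have hfin := energy_lt_top hN ha haN hv
  have h : 4 * energy a E < 4 * energy a (polarize e s E) := by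
    rw [four_mul_energy a he s hE, four_mul_energy a he s (measurableSet_polarize e s hE)]
    refine lintegral_strict_mono_of_ae_le_of_ae_lt_on
      (measurable_interaction a e s (measurableSet_polarize e s hE)).aemeasurable ?_
      (Filter.Eventually.of_forall fun p => interaction_le_polarize ha.le he s E p)
      (s := gained e s E ×ˢ dominant e s E) ?_ (Filter.Eventually.of_forall ?_)
    · rw [← four_mul_energy a he s hE]
      exact ENNReal.mul_ne_top (by simp) hfin.ne
    · rw [Measure.volume_eq_prod, Measure.prod_prod]
      exact (ENNReal.mul_pos hg.ne' hd.ne').ne'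
    · rintro ⟨x, y⟩ ⟨⟨hx1, hx2, hx3⟩, ⟨hy1, hy2, hy3⟩⟩
      simp only at hx1 hx2 hx3 hy1 hy2 hy3
      have h1 := mem_polarize_of_le he E hx1.le
      have h2 := mem_polarize_of_le he E hy1.le
      have hk := kernel_refl_lt ha he s (x := x) (y := y)
        (mul_pos_of_neg_of_neg (by linarith) (by linarith))
      simp [interaction, ind, h1, h2, hx2, hx3, hy2, hy3, hk]
  exact (ENNReal.mul_lt_mul_iff_right (by simp) (by simp)).1 h

theorem symmDiff_polarize_subset {e : Eu N} (he : ‖e‖ = 1) (s : ℝ) (E : Set (Eu N)) :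
    polarize e s E ∆ E ⊆ gained e s E ∪ refl e s ⁻¹' gained e s E := by
  intro x hx
  rcases lt_trichotomy (⟪x, e⟫) s with h | h | h
  · have h1 := mem_polarize_of_le he E h.le
    left
    rw [Set.mem_symmDiff] at hx
    refine ⟨h, ?_⟩
    tauto
  · have h1 := mem_polarize_of_le he E h.le
    rw [refl_of_inner_eq h] at h1
    rw [Set.mem_symmDiff] at hx
    tauto
  · have h1 := mem_polarize_of_ge he E h.le
    right
    rw [Set.mem_symmDiff] at hx
    refine ⟨by rw [inner_refl he]; linarith, ?_⟩
    rw [refl_refl he]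
    tauto

theorem volume_symmDiff_polarize_le {e : Eu N} (he : ‖e‖ = 1) (s : ℝ) {E : Set (Eu N)}
    (hE : MeasurableSet E) : volume (polarize e s E ∆ E) ≤ 2 * volume (gained e s E) := by
  refine (measure_mono (symmDiff_polarize_subset he s E)).trans ((measure_union_le _ _).trans ?_)
  rw [(measurePreserving_refl he s).measure_preimage
    (measurableSet_gained e s hE).nullMeasurableSet, two_mul]

/-- Polarization towards the center of a ball brings a set closer to that ball. -/
theorem volume_symmDiff_ball_polarize_le {e : Eu N} (he : ‖e‖ = 1) {s : ℝ} (hs : 0 ≤ s)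
    {E : Set (Eu N)} (hE : MeasurableSet E) (r : ℝ) :
    volume (polarize e s E ∆ ball 0 r) +
      2 * volume {x | x ∈ E \ ball 0 r ∧ refl e s x ∈ ball 0 r \ E} ≤ volume (E ∆ ball 0 r) := by
  have hB : MeasurableSet (ball (0 : Eu N) r) := measurableSet_ball
  have hP := measurableSet_polarize e s hE
  obtain ⟨T, hTdef⟩ : ∃ T, T = {x | x ∈ E \ ball 0 r ∧ refl e s x ∈ ball 0 r \ E} := ⟨_, rfl⟩
  have hTm (x) : x ∈ T ↔ (x ∈ E ∧ x ∉ ball (0 : Eu N) r) ∧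
    (refl e s x ∈ ball (0 : Eu N) r ∧ refl e s x ∉ E) := by rw [hTdef]; rfl
  rw [← hTdef]
  have hT : MeasurableSet T := hTdef ▸ (hE.diff hB).inter (measurable_refl e s (hB.diff hE))
  have hm : Measurable fun x => ind T x + ind T (refl e s x) :=
    (measurable_ind hT).add ((measurable_ind hT).comp (measurable_refl e s))
  have h : 2 * (volume (polarize e s E ∆ ball 0 r) + 2 * volume T)
      ≤ 2 * volume (E ∆ ball 0 r) := by
    have : 2 * (volume (polarize e s E ∆ ball 0 r) + 2 * volume T) =
      2 * volume (polarize e s E ∆ ball 0 r) + 2 * (2 * volume T) := by ring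
    rw [this, two_mul_measure he s (hE.symmDiff hB), two_mul_measure he s (hP.symmDiff hB),
      two_mul_measure he s hT, ← lintegral_const_mul _ hm, ← lintegral_add_right _ (by fun_prop)]
    refine lintegral_mono fun x => ?_
    have hn := norm_sq_refl he s x
    rcases le_total (⟪x, e⟫) s with h | h
    · have h1 := mem_polarize_of_le he E h
      have h2 : refl e s x ∈ ball (0 : Eu N) r → x ∈ ball (0 : Eu N) r := by
        rw [mem_ball_zero_iff, mem_ball_zero_iff]
        refine fun h3 => lt_of_le_of_lt ?_ h3
        refine (pow_le_pow_iff_left₀ (norm_nonneg _) (norm_nonneg _) two_ne_zero).1 ?_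
        nlinarith
      by_cases a1 : x ∈ E <;> by_cases a2 : refl e s x ∈ E <;>
      by_cases a3 : x ∈ ball (0 : Eu N) r <;>
      by_cases a4 : refl e s x ∈ ball (0 : Eu N) r <;>
      first
      | exact absurd (h2 a4) a3
      | simp only [ind_eq_ite, Set.mem_symmDiff, hTm, refl_refl he, h1, a1, a2, a3, a4]; norm_num
    · have h1 := mem_polarize_of_ge he E h
      have h2 : x ∈ ball (0 : Eu N) r → refl e s x ∈ ball (0 : Eu N) r := by
        rw [mem_ball_zero_iff, mem_ball_zero_iff]
        refine fun h3 => lt_of_le_of_lt ?_ h3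
        refine (pow_le_pow_iff_left₀ (norm_nonneg _) (norm_nonneg _) two_ne_zero).1 ?_
        nlinarith
      by_cases a1 : x ∈ E <;> by_cases a2 : refl e s x ∈ E <;>
      by_cases a3 : x ∈ ball (0 : Eu N) r <;>
      by_cases a4 : refl e s x ∈ ball (0 : Eu N) r <;>
      first
      | exact absurd (h2 a3) a4
      | simp only [ind_eq_ite, Set.mem_symmDiff, hTm, refl_refl he, h1, a1, a2, a3, a4]; norm_num
  exact (ENNReal.mul_le_mul_iff_right (by simp) (by simp)).1 h

theorem lintegral_comp_sub_half {f : ℝ → ℝ≥0∞} (hf : Measurable f) (c : ℝ) :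
    ∫⁻ t, f (c - 2⁻¹ * t) = 2 * ∫⁻ s, f s := by
  have h := Real.map_volume_mul_left (a := 2⁻¹) (by norm_num)
  have h1 : Measurable fun t => f (c - t) := by fun_prop
  rw [← lintegral_map (μ := volume) (f := fun t => f (c - t)) h1 (measurable_const_mul (2⁻¹ : ℝ)), h,
    lintegral_smul_measure, (volume.measurePreserving_sub_left c).lintegral_comp hf]
  norm_num

theorem volume_le_lintegral_refl (hN : 2 ≤ N) {R : ℝ} {x : Eu N} {C : Set (Eu N)}
    (hC : MeasurableSet C) (hx : ‖x‖ < R) (hCx : ∀ y ∈ C, ‖y‖ < ‖x‖) :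
    volume C ≤ ENNReal.ofReal ((2 * R) ^ (N - 1)) * 2 *
      ∫⁻ e, (∫⁻ s in Set.Ioo 0 R, ind C (refl (e : Eu N) s x)) ∂(volume : Measure (Eu N)).toSphere := by
  have hm := measurable_ind hC
  have h1 : volume C = ∫⁻ y, ind C (x - y) := by
    rw [(volume.measurePreserving_sub_left x).lintegral_comp hm, lintegral_ind hC]
  have hmm : Measurable fun p : sphere (0 : Eu N) 1 × ℝ => ind C (refl (p.1 : Eu N) p.2 x) := by
    refine hm.comp (Continuous.measurable ?_)
    have := continuous_refl_uncurry (N := N)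
    exact this.comp (f := fun p : sphere (0 : Eu N) 1 × ℝ => ((p.1 : Eu N), p.2, x)) (by fun_prop)
  have hm2 : Measurable fun e : sphere (0 : Eu N) 1 =>
      ∫⁻ s in Set.Ioo 0 R, ind C (refl (e : Eu N) s x) := hmm.lintegral_prod_right'
  rw [h1, lintegral_polar hN (by fun_prop), ← lintegral_const_mul _ hm2]
  refine lintegral_mono fun e => ?_
  have he : ‖(e : Eu N)‖ = 1 := by simp
  set g : ℝ → ℝ≥0∞ := (Set.Ioo 0 R).indicator (fun s => ind C (refl (e : Eu N) s x)) with hg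
  have hgm : Measurable g := (hmm.comp measurable_prodMk_left).indicator measurableSet_Ioo
  have hR : 0 ≤ 2 * R := by linarith [norm_nonneg x]
  calc ∫⁻ t in Set.Ioi 0, ENNReal.ofReal (t ^ (N - 1)) * ind C (x - t • (e : Eu N))
      ≤ ∫⁻ t in Set.Ioi 0, ENNReal.ofReal ((2 * R) ^ (N - 1)) * g (⟪x, e⟫ - 2⁻¹ * t) := by
        refine setLIntegral_mono' measurableSet_Ioi fun t (ht : 0 < t) => ?_
        by_cases hc : x - t • (e : Eu N) ∈ C
        · have h2 := hCx _ hc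
          have h3 : t ≤ 2 * R := by
            have : ‖x - (x - t • (e : Eu N))‖ = t := by
              rw [sub_sub_cancel, norm_smul, he, mul_one, Real.norm_of_nonneg ht.le]
            have h4 := norm_sub_le x (x - t • (e : Eu N))
            linarith
          have h5 : refl (e : Eu N) (⟪x, e⟫ - 2⁻¹ * t) x = x - t • (e : Eu N) := by
            rw [refl]; congr 2; ring
          have h6 : ⟪x, e⟫ - 2⁻¹ * t ∈ Set.Ioo 0 R := by
            have h7 := pow_lt_pow_left₀ h2 (norm_nonneg _) two_ne_zero
            rw [norm_sub_sq_real, inner_smul_right, norm_smul, he, Real.norm_of_nonneg ht.le] at h7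
            have h8 := real_inner_le_norm x (e : Eu N)
            rw [he] at h8
            constructor
            · by_contra h9
              nlinarith
            · linarith
          rw [hg, Set.indicator_of_mem h6, h5]
          gcongr
        · rw [ind_of_notMem hc]; simp
    _ ≤ ∫⁻ t, ENNReal.ofReal ((2 * R) ^ (N - 1)) * g (⟪x, e⟫ - 2⁻¹ * t) :=
        setLIntegral_le_lintegral _ _
    _ = _ := by
        rw [lintegral_const_mul _ (by fun_prop), lintegral_comp_sub_half hgm,
          hg, lintegral_indicator measurableSet_Ioo, mul_assoc]

/-- Two sets separated by their distance to the origin are exchanged to a definite amount by some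
reflection. -/
theorem exists_refl_volume_ge (hN : 2 ≤ N) (R : ℝ) :
    ∃ c : ℝ≥0∞, 0 < c ∧ c < ⊤ ∧ ∀ A C : Set (Eu N), MeasurableSet A → MeasurableSet C →
      A ⊆ ball 0 R → (∀ x ∈ A, ∀ y ∈ C, ‖y‖ < ‖x‖) →
      ∃ (e : Eu N) (s : ℝ), ‖e‖ = 1 ∧ 0 < s ∧
        c * volume A * volume C ≤ volume {x | x ∈ A ∧ refl e s x ∈ C} := by
  set σ := (volume : Measure (Eu N)).toSphere
  set K : ℝ≥0∞ := ENNReal.ofReal ((2 * R) ^ (N - 1)) * 2 * (σ Set.univ * ENNReal.ofReal R) with hK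
  have hKtop : K < ⊤ := by
    refine ENNReal.mul_lt_top (ENNReal.mul_lt_top ENNReal.ofReal_lt_top (by simp))
      (ENNReal.mul_lt_top (measure_lt_top _ _) ENNReal.ofReal_lt_top)
  refine ⟨(K + 1)⁻¹, by simpa using hKtop.ne, by simp, fun A C hA hC hAR hAC => ?_⟩
  have hunit : ∃ e : Eu N, ‖e‖ = 1 := ⟨EuclideanSpace.single ⟨0, by omega⟩ 1, by simp⟩
  by_contra! hcon
  obtain ⟨e0, he0⟩ := hunit
  have hpos : 0 < volume A * volume C := by
    have h := hcon e0 1 he0 one_pos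
    rw [mul_assoc] at h
    exact pos_of_mul_pos_right (bot_le.trans_lt h) (by simp)
  have hAfin : volume A < ⊤ := (measure_mono hAR).trans_lt measure_ball_lt_top
  have hCne : (volume C) < ⊤ := by
    have : volume A ≠ 0 := left_ne_zero_of_mul hpos.ne'
    obtain ⟨x, hx⟩ := nonempty_of_measure_ne_zero this
    have : C ⊆ ball 0 R := fun y hy => by
      have h1 := hAR hx
      rw [mem_ball_zero_iff] at h1 ⊢
      exact (hAC x hx y hy).trans h1
    exact (measure_mono this).trans_lt measure_ball_lt_top
  have hm := measurable_ind hC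
  have hmm : Measurable fun p : Eu N × (sphere (0 : Eu N) 1 × ℝ) =>
      ind C (refl (p.2.1 : Eu N) p.2.2 p.1) := by
    refine hm.comp (Continuous.measurable ?_)
    have := continuous_refl_uncurry (N := N)
    exact this.comp (f := fun p : Eu N × (sphere (0 : Eu N) 1 × ℝ) =>
      ((p.2.1 : Eu N), p.2.2, p.1)) (by fun_prop)
  have hmm' : ∀ x, Measurable fun p : sphere (0 : Eu N) 1 × ℝ =>
      ind C (refl (p.1 : Eu N) p.2 x) := fun x => hmm.comp measurable_prodMk_left
  have key : volume A * volume C ≤ K * ((K + 1)⁻¹ * (volume A * volume C)) := by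
    calc volume A * volume C = ∫⁻ x in A, volume C := by rw [setLIntegral_const, mul_comm]
      _ ≤ ∫⁻ x in A, ENNReal.ofReal ((2 * R) ^ (N - 1)) * 2 *
          ∫⁻ p, ind C (refl (p.1 : Eu N) p.2 x) ∂(σ.prod (volume.restrict (Set.Ioo 0 R))) := by
        refine setLIntegral_mono' hA fun x hx => ?_
        refine (volume_le_lintegral_refl hN hC (mem_ball_zero_iff.1 (hAR hx)) (hAC x hx)).trans_eq ?_
        rw [lintegral_prod _ (hmm' x).aemeasurable]
      _ = ENNReal.ofReal ((2 * R) ^ (N - 1)) * 2 * ∫⁻ x in A,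
          ∫⁻ p, ind C (refl (p.1 : Eu N) p.2 x) ∂(σ.prod (volume.restrict (Set.Ioo 0 R))) := by
        rw [lintegral_const_mul _ hmm.lintegral_prod_right']
      _ = ENNReal.ofReal ((2 * R) ^ (N - 1)) * 2 * ∫⁻ p, (∫⁻ x in A,
          ind C (refl (p.1 : Eu N) p.2 x)) ∂(σ.prod (volume.restrict (Set.Ioo 0 R))) := by
        rw [lintegral_lintegral_swap hmm.aemeasurable]
      _ ≤ ENNReal.ofReal ((2 * R) ^ (N - 1)) * 2 * ∫⁻ p, (K + 1)⁻¹ * (volume A * volume C)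
            ∂(σ.prod (volume.restrict (Set.Ioo 0 R))) := by
        refine mul_le_mul_right ?_ _
        rw [lintegral_prod _ hmm.lintegral_prod_left'.aemeasurable,
          lintegral_prod _ aemeasurable_const]
        refine lintegral_mono fun e => setLIntegral_mono' measurableSet_Ioo fun s hs => ?_
        have h := (hcon e s (by simp) hs.1).le
        rw [mul_assoc] at h
        refine le_trans ?_ h
        have hme := measurable_refl (e : Eu N) s hC
        calc ∫⁻ x in A, ind C (refl (e : Eu N) s x)
            = ∫⁻ x in A, ind (refl (e : Eu N) s ⁻¹' C) x := rfl
          _ = volume.restrict A (refl (e : Eu N) s ⁻¹' C) := lintegral_indicator_one hme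
          _ ≤ _ := by
            rw [Measure.restrict_apply hme]
            exact measure_mono fun x hx => ⟨hx.2, hx.1⟩
      _ = _ := by
        rw [lintegral_const, ← Set.univ_prod_univ, Measure.prod_prod, Measure.restrict_apply_univ,
          Real.volume_Ioo, sub_zero, hK]
        ring
  have h1 : volume A * volume C = (K + 1) * ((K + 1)⁻¹ * (volume A * volume C)) := by
    rw [← mul_assoc, ENNReal.mul_inv_cancel (by simp) (by simpa using hKtop.ne), one_mul]
  set W := (K + 1)⁻¹ * (volume A * volume C)
  have hW : W < ⊤ := ENNReal.mul_lt_top (by simp) (ENNReal.mul_lt_top hAfin hCne)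
  have hW0 : W ≠ 0 := by
    intro h
    rw [h, mul_zero] at h1
    exact hpos.ne' h1
  rw [h1, add_mul, one_mul] at key
  exact absurd key (ENNReal.lt_add_right (ENNReal.mul_lt_top hKtop hW).ne hW0).not_ge

theorem measure_sdiff_comm {X : Type*} [MeasurableSpace X] {μ : Measure X} {E G : Set X}
    (hE : MeasurableSet E) (hG : MeasurableSet G) (h : μ E = μ G) (hv : μ E < ⊤) :
    μ (E \ G) = μ (G \ E) := by
  have h1 := measure_inter_add_sdiff (μ := μ) E hG
  have h2 := measure_inter_add_sdiff (μ := μ) G hE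
  rw [Set.inter_comm, ← h, ← h1] at h2
  exact ((ENNReal.add_right_inj (measure_ne_top_of_subset Set.inter_subset_left hv.ne)).1 h2).symm

theorem volume_symmDiff_eq {E G : Set (Eu N)} (hE : MeasurableSet E) (hG : MeasurableSet G)
    (h : volume E = volume G) (hv : volume E < ⊤) : volume (E ∆ G) = 2 * volume (E \ G) := by
  rw [Set.symmDiff_def, measure_union disjoint_sdiff_sdiff (hG.diff hE), measure_sdiff_comm hE hG h hv,
    two_mul]

theorem volume_ball_lt_top (x : Eu N) (r : ℝ) : volume (ball x r) < ⊤ := measure_ball_lt_top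

/-- The Riesz rearrangement inequality: balls maximize the energy. -/
theorem energy_le_ball (hN : 2 ≤ N) {a : ℝ} (ha0 : 0 < a) (ha : a < N) {E : Set (Eu N)}
    (hE : MeasurableSet E) (hv : volume E = volume (ball (0 : Eu N) 1)) (hsub : E ⊆ ball 0 2) :
    energy a E ≤ energy a (ball (0 : Eu N) 1) := by
  set B := ball (0 : Eu N) 1 with hB
  have hBm : MeasurableSet B := measurableSet_ball
  have hBt : volume B < ⊤ := volume_ball_lt_top _ _
  obtain ⟨c, hc0, hct, hc⟩ := exists_refl_volume_ge hN 2
  set P : Set (Eu N) → Prop := fun G => MeasurableSet G ∧ volume G = volume B ∧ G ⊆ ball 0 2 ∧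
    energy a E ≤ energy a G with hP
  set d : ℝ≥0∞ := ⨅ (G : Set (Eu N)) (_ : P G), volume (G ∆ B) with hd
  have hdle : ∀ G, P G → d ≤ volume (G ∆ B) := fun G hG => iInf₂_le G hG
  have hPE : P E := ⟨hE, hv, hsub, le_rfl⟩
  have hd0 : d = 0 := by
    by_contra hne
    have hdt : d < ⊤ := (hdle E hPE).trans_lt
      ((measure_mono (Set.symmDiff_subset_union)).trans_lt
        ((measure_union_le _ _).trans_lt (ENNReal.add_lt_top.2 ⟨hv ▸ hBt, hBt⟩)))
    have hlt : d < d + 2 * (c * (d / 2) * (d / 2)) := by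
      refine ENNReal.lt_add_right hdt.ne ?_
      simp [hc0.ne', hne]
    obtain ⟨G, hG, hGlt⟩ : ∃ G, P G ∧ volume (G ∆ B) < d + 2 * (c * (d / 2) * (d / 2)) := by
      simpa [hd, iInf_lt_iff] using hlt
    have hGt : volume G < ⊤ := hG.2.1 ▸ hBt
    have hs := volume_symmDiff_eq hG.1 hBm hG.2.1 hGt
    have hA : d / 2 ≤ volume (G \ B) := by
      rw [ENNReal.div_le_iff (by simp) (by simp), mul_comm, ← hs]
      exact hdle G hG
    obtain ⟨e, s, he, hs0, hge⟩ := hc (G \ B) (B \ G) (hG.1.diff hBm) (hBm.diff hG.1)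
      (Set.sdiff_subset.trans hG.2.2.1) (fun x hx y hy => by
        have h1 := hx.2
        have h2 := hy.1
        rw [hB, mem_ball_zero_iff] at h1 h2
        linarith)
    have hpol := volume_symmDiff_ball_polarize_le he hs0.le hG.1 1
    have hPp : P (polarize e s G) := ⟨measurableSet_polarize e s hG.1,
      (volume_polarize he s hG.1).trans hG.2.1, polarize_subset_ball he hs0.le hG.2.2.1,
      hG.2.2.2.trans (energy_le_polarize ha0.le he s hG.1)⟩
    refine absurd hGlt (not_lt.2 (le_trans ?_ hpol))
    rw [← measure_sdiff_comm hG.1 hBm hG.2.1 hGt] at hge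
    refine add_le_add (hdle _ hPp) (mul_le_mul_right (le_trans ?_ hge) _)
    gcongr
  obtain ⟨M, hM, hMle⟩ := exists_energy_le_add hN ha0 ha hBt
  refine ENNReal.le_of_forall_pos_le_add fun η hη _ => ?_
  have hη' : 0 < (η : ℝ≥0∞) / (M + 1) := ENNReal.div_pos (by simpa using hη.ne') (by simpa using hM.ne)
  obtain ⟨G, hG, hGlt⟩ : ∃ G, P G ∧ volume (G ∆ B) < (η : ℝ≥0∞) / (M + 1) := by
    rw [← hd0] at hη'
    simpa [hd, iInf_lt_iff] using hη'
  refine hG.2.2.2.trans ((hMle G B hG.2.1.le le_rfl).trans ?_)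
  gcongr
  calc M * volume (G \ B) ≤ (M + 1) * ((η : ℝ≥0∞) / (M + 1)) := by
        gcongr
        · simp
        · exact (measure_mono Set.subset_union_left).trans hGlt.le
    _ ≤ η := ENNReal.mul_div_le

theorem volume_hyperplane {e : Eu N} (he : ‖e‖ = 1) (s : ℝ) :
    volume {x : Eu N | ⟪x, e⟫ = s} = 0 := by
  have h1 : volume ((ℝ ∙ e)ᗮ : Set (Eu N)) = 0 := by
    refine Measure.addHaar_submodule _ _ fun h => ?_
    have h2 : e ∈ (ℝ ∙ e)ᗮ := h ▸ Submodule.mem_top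
    rw [Submodule.mem_orthogonal_singleton_iff_inner_right, real_inner_self_eq_norm_sq, he] at h2
    norm_num at h2
  rw [← measure_preimage_add_right volume (-(s • e))] at h1
  convert h1 using 2
  ext x
  simp only [Set.mem_ofPred_eq, Set.mem_preimage, SetLike.mem_coe,
    Submodule.mem_orthogonal_singleton_iff_inner_left, inner_add_left, inner_neg_left, inner_smul_left,
    real_inner_self_eq_norm_sq, he]
  simp [← sub_eq_add_neg, sub_eq_zero]

theorem gained_subset (e : Eu N) (s s' : ℝ) (E : Set (Eu N)) :
    gained e s E ⊆ gained e s' E ∪ (((refl e s ⁻¹' E) ∆ (refl e s' ⁻¹' E)) ∪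
      (refl e s' ⁻¹' E ∩ {x | ⟪x, e⟫ ∈ Set.Icc (s' - |s - s'|) (s' + |s - s'|)})) := by
  rintro x ⟨h1, h2, h3⟩
  by_cases h4 : refl e s' x ∈ E
  · by_cases h5 : ⟪x, e⟫ < s'
    · exact Or.inl ⟨h5, h2, h4⟩
    · refine Or.inr (Or.inr ⟨h4, ?_⟩)
      have := le_abs_self (s - s')
      have := abs_nonneg (s - s')
      exact ⟨by linarith, by linarith⟩
  · exact Or.inr (Or.inl (Or.inl ⟨h3, h4⟩))

theorem gained_subset' (e : Eu N) (s s' : ℝ) (E : Set (Eu N)) :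
    gained e s' E ⊆ gained e s E ∪ (((refl e s ⁻¹' E) ∆ (refl e s' ⁻¹' E)) ∪
      (refl e s' ⁻¹' E ∩ {x | ⟪x, e⟫ ∈ Set.Icc (s' - |s - s'|) (s' + |s - s'|)})) := by
  rintro x ⟨h1, h2, h3⟩
  by_cases h4 : refl e s x ∈ E
  · by_cases h5 : ⟪x, e⟫ < s
    · exact Or.inl ⟨h5, h2, h4⟩
    · refine Or.inr (Or.inr ⟨h3, ?_⟩)
      have := neg_abs_le (s - s')
      have := abs_nonneg (s - s')
      exact ⟨by linarith, by linarith⟩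
  · exact Or.inr (Or.inl (Or.inr ⟨h3, h4⟩))

theorem continuous_volume_gained {e : Eu N} (he : ‖e‖ = 1) {E : Set (Eu N)} (hE : MeasurableSet E)
    (hv : volume E < ⊤) : Continuous fun s => volume (gained e s E) := by
  refine continuous_iff_continuousAt.2 fun s' => ?_
  set d : ℝ → ℝ≥0∞ := fun s => volume ((refl e s ⁻¹' E) ∆ (refl e s' ⁻¹' E)) +
    volume (refl e s' ⁻¹' E ∩ {x | ⟪x, e⟫ ∈ Set.Icc (s' - |s - s'|) (s' + |s - s'|)}) with hd
  have hm := measurable_refl e s' hE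
  have hmi : Measurable fun x : Eu N => ⟪x, e⟫ := by fun_prop
  have hvol (s) : volume (refl e s ⁻¹' E) = volume E :=
    (measurePreserving_refl he s).measure_preimage hE.nullMeasurableSet
  have h1 : Filter.Tendsto (fun s => volume ((refl e s ⁻¹' E) ∆ (refl e s' ⁻¹' E)))
      (nhds s') (nhds 0) := by
    let F : C(ℝ × Eu N, Eu N) := ⟨fun p => refl e p.1 p.2, by unfold refl; fun_prop⟩
    exact tendsto_measure_symmDiff_preimage_nhds_zero (f := F.curry) (g := F.curry s')
      (F.curry.continuous.tendsto s') (Filter.Eventually.of_forall fun s => measurePreserving_refl he s)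
      (measurePreserving_refl he s') hE.nullMeasurableSet hv.ne
  have h2 : Filter.Tendsto (fun s => volume (refl e s' ⁻¹' E ∩
      {x | ⟪x, e⟫ ∈ Set.Icc (s' - |s - s'|) (s' + |s - s'|)})) (nhds s') (nhds 0) := by
    set μ : Measure ℝ := (volume.restrict (refl e s' ⁻¹' E)).map (fun x => ⟪x, e⟫) with hμ
    have hfin : IsFiniteMeasure (volume.restrict (refl e s' ⁻¹' E)) :=
      ⟨by rw [Measure.restrict_apply_univ, hvol]; exact hv⟩
    have hfin2 : IsFiniteMeasure μ := Measure.isFiniteMeasure_map _ _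
    have hna : NullSingletonClass μ := ⟨fun t => by
      rw [hμ, Measure.map_apply hmi (measurableSet_singleton t)]
      exact le_antisymm ((Measure.restrict_apply_le _ _).trans_eq (volume_hyperplane he t)) bot_le⟩
    have h3 := (tendsto_measure_Icc μ s').comp
      (show Filter.Tendsto (fun s => |s - s'|) (nhds s') (nhds 0) by
        have : Continuous fun s => |s - s'| := by fun_prop
        simpa using this.tendsto s')
    refine h3.congr fun s => ?_
    rw [Function.comp_apply, hμ, Measure.map_apply hmi measurableSet_Icc,
      Measure.restrict_apply (hmi measurableSet_Icc), Set.inter_comm]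
    rfl
  have h3 : Filter.Tendsto d (nhds s') (nhds 0) := by
    have := h1.add h2
    rwa [add_zero] at this
  have hfin : volume (gained e s' E) ≠ ⊤ := by
    refine ((measure_mono fun x hx => ?_).trans_lt ((hvol s').trans_lt hv)).ne
    exact hx.2.2
  refine tendsto_of_tendsto_of_tendsto_of_le_of_le (g := fun s => volume (gained e s' E) - d s)
    (h := fun s => volume (gained e s' E) + d s) ?_ ?_ (fun s => ?_) (fun s => ?_)
  · simpa using ENNReal.Tendsto.sub (tendsto_const_nhds (x := volume (gained e s' E))) h3
      (Or.inl hfin)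
  · simpa using h3.const_add (volume (gained e s' E))
  · refine tsub_le_iff_right.2 ((measure_mono (gained_subset' e s s' E)).trans
      ((measure_union_le _ _).trans ?_))
    gcongr
    exact measure_union_le _ _
  · refine (measure_mono (gained_subset e s s' E)).trans ((measure_union_le _ _).trans ?_)
    simp only [hd]
    gcongr
    exact measure_union_le _ _

theorem refl_neg (e : Eu N) (s : ℝ) : refl (-e) (-s) = refl e s := by
  ext1 x
  rw [refl, refl, inner_neg_right]
  module

theorem gained_neg {e : Eu N} (he : ‖e‖ = 1) (s : ℝ) (E : Set (Eu N)) :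
    gained (-e) (-s) E = refl e s ⁻¹' dominant e s E := by
  ext x
  simp only [gained, dominant, refl_neg, Set.mem_preimage, Set.mem_ofPred_eq, inner_refl he,
    refl_refl he, inner_neg_right]
  constructor
  · rintro ⟨h1, h2, h3⟩
    exact ⟨by linarith, h3, h2⟩
  · rintro ⟨h1, h2, h3⟩
    exact ⟨by linarith, h3, h2⟩

theorem volume_gained_neg {e : Eu N} (he : ‖e‖ = 1) (s : ℝ) {E : Set (Eu N)}
    (hE : MeasurableSet E) : volume (gained (-e) (-s) E) = volume (dominant e s E) := by
  rw [gained_neg he, (measurePreserving_refl he s).measure_preimage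
    (measurableSet_dominant e s hE).nullMeasurableSet]

theorem volume_dominant_neg {e : Eu N} (he : ‖e‖ = 1) (s : ℝ) {E : Set (Eu N)}
    (hE : MeasurableSet E) : volume (dominant (-e) (-s) E) = volume (gained e s E) := by
  have := volume_gained_neg (e := -e) (by simpa using he) (-s) hE
  rw [neg_neg, neg_neg] at this
  exact this.symm

theorem volume_gained_eq_zero {e : Eu N} (he : ‖e‖ = 1) (s : ℝ) {E : Set (Eu N)}
    (hE : MeasurableSet E) {R : ℝ} (hR : E ⊆ ball 0 R) (hd : volume (dominant e s E) = 0)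
    (hI : ∫ x in E, (⟪x, e⟫ - s) ≤ 0) : volume (gained e s E) = 0 := by
  have hσ := measurePreserving_refl he s
  have hemb : MeasurableEmbedding (refl e s) :=
    (continuous_refl e s).measurableEmbedding (fun x y h => by
      rw [← refl_refl he s x, h, refl_refl he])
  set f : Eu N → ℝ := E.indicator fun x => ⟪x, e⟫ - s with hf
  have hfi : Integrable f := by
    rw [hf, integrable_indicator_iff hE]
    refine IntegrableOn.mono_set ?_ (hR.trans ball_subset_closedBall)
    exact ContinuousOn.integrableOn_compact (isCompact_closedBall _ _) (by fun_prop)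
  have hfi2 : Integrable (fun x => f (refl e s x)) := (hσ.integrable_comp_emb hemb).2 hfi
  have hint : ∫ x, (f x + f (refl e s x)) ≤ 0 := by
    rw [integral_add hfi hfi2, hσ.integral_comp hemb, hf, integral_indicator hE]
    linarith
  have hae : ∀ᵐ x, x ∉ dominant e s E := measure_eq_zero_iff_ae_notMem.1 hd
  have hae2 : ∀ᵐ x, refl e s x ∉ dominant e s E := hσ.quasiMeasurePreserving.ae hae
  have hnn : 0 ≤ᵐ[volume] fun x => f x + f (refl e s x) := by
    filter_upwards [hae, hae2] with x h1 h2
    simp only [dominant, Set.mem_ofPred_eq, inner_refl he, refl_refl he, not_and, not_not] at h1 h2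
    classical
    simp only [Pi.zero_apply, hf, Set.indicator_apply, inner_refl he]
    split_ifs with h3 h4 h4
    · linarith
    · by_contra h5
      exact h4 (h1 (by linarith) h3)
    · by_contra h5
      exact h3 (h2 (by linarith) h4)
    · simp
  have h0 := (integral_eq_zero_iff_of_nonneg_ae hnn (hfi.add hfi2)).1
    (le_antisymm hint (integral_nonneg_of_ae hnn))
  rw [measure_eq_zero_iff_ae_notMem]
  filter_upwards [h0] with x hx
  rintro ⟨h1, h2, h3⟩
  simp only [hf, Set.indicator_of_notMem h2, Set.indicator_of_mem h3, inner_refl he,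
    Pi.zero_apply] at hx
  linarith

theorem volume_dominant_eq_zero {e : Eu N} (he : ‖e‖ = 1) (s : ℝ) {E : Set (Eu N)}
    (hE : MeasurableSet E) {R : ℝ} (hR : E ⊆ ball 0 R) (hg : volume (gained e s E) = 0)
    (hI : 0 ≤ ∫ x in E, (⟪x, e⟫ - s)) : volume (dominant e s E) = 0 := by
  rw [← volume_gained_neg he s hE]
  refine volume_gained_eq_zero (by simpa using he) _ hE hR ?_ ?_
  · rw [volume_dominant_neg he s hE, hg]
  · have : ∀ x : Eu N, ⟪x, -e⟫ - -s = -(⟪x, e⟫ - s) := fun x => by rw [inner_neg_right]; ring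
    simp only [this, integral_neg]
    linarith

theorem ae_mem_iff_refl_mem {e : Eu N} (he : ‖e‖ = 1) {s : ℝ} {E : Set (Eu N)}
    (hg : volume (gained e s E) = 0) (hd : volume (dominant e s E) = 0) :
    ∀ᵐ x, (refl e s x ∈ E ↔ x ∈ E) := by
  have hσ := (measurePreserving_refl he s).quasiMeasurePreserving
  have a1 : ∀ᵐ x, x ∉ dominant e s E := measure_eq_zero_iff_ae_notMem.1 hd
  have a2 : ∀ᵐ x, x ∉ gained e s E := measure_eq_zero_iff_ae_notMem.1 hg
  filter_upwards [a1, hσ.ae a1, a2, hσ.ae a2] with x h1 h2 h3 h4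
  simp only [dominant, gained, Set.mem_ofPred_eq, inner_refl he, refl_refl he, not_and, not_not]
    at h1 h2 h3 h4
  rcases lt_trichotomy (⟪x, e⟫) s with h | h | h
  · tauto
  · rw [refl_of_inner_eq h]
  · have h' : 2 * s - ⟪x, e⟫ < s := by linarith
    tauto

theorem exists_barycenter {E : Set (Eu N)} (hv0 : 0 < volume E)
    (hv : volume E < ⊤) {R : ℝ} (hR : E ⊆ ball 0 R) :
    ∃ b : Eu N, ∀ (e : Eu N) (s : ℝ),
      ∫ x in E, (⟪x, e⟫ - s) = (volume E).toReal * (⟪b, e⟫ - s) := by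
  refine ⟨(volume E).toReal⁻¹ • ∫ x in E, x, fun e s => ?_⟩
  have hi : IntegrableOn (fun x : Eu N => x) E :=
    (ContinuousOn.integrableOn_compact (isCompact_closedBall 0 R) (by fun_prop)).mono_set
      (hR.trans ball_subset_closedBall)
  have hi2 : IntegrableOn (fun x : Eu N => ⟪x, e⟫) E :=
    (ContinuousOn.integrableOn_compact (isCompact_closedBall 0 R) (by fun_prop)).mono_set
      (hR.trans ball_subset_closedBall)
  have h1 : ∫ x in E, ⟪x, e⟫ = ⟪∫ x in E, x, e⟫ := by
    rw [real_inner_comm, ← integral_inner hi e]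
    simp only [real_inner_comm]
  have hpos : 0 < (volume E).toReal := ENNReal.toReal_pos hv0.ne' hv.ne
  rw [integral_sub hi2 (integrableOn_const hv.ne), h1, setIntegral_const, inner_smul_left]
  simp only [measureReal_def, smul_eq_mul, conj_trivial]
  field_simp

theorem refl_refl_comm {e : Eu N} (he : ‖e‖ = 1) (β s : ℝ) (x : Eu N) :
    refl (-e) (s - 2 * β) (refl e β x) = refl e β (refl e s x) := by
  have h : s - 2 * β = -(2 * β - s) := by ring
  rw [h, refl_neg, refl, inner_refl he, refl, refl, inner_refl he, refl]
  module

/-- If no polarization towards the origin close to `E` increases the energy, then every hyperplane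
with the barycenter on its negative side gains nothing. -/
theorem volume_gained_eq_zero_of_forall {e : Eu N} (he : ‖e‖ = 1)
    {E : Set (Eu N)} (hE : MeasurableSet E) (hv : volume E < ⊤) {R : ℝ} (hR : E ⊆ ball 0 R)
    {b : Eu N} (hb : ∀ (e : Eu N) (s : ℝ),
      ∫ x in E, (⟪x, e⟫ - s) = (volume E).toReal * (⟪b, e⟫ - s)) {η : ℝ≥0∞} (hη : 0 < η)
    (hno : ∀ s, 0 ≤ s → 0 < volume (gained e s E) → 0 < volume (dominant e s E) →
      η ≤ volume (gained e s E)) {s : ℝ} (hs0 : 0 ≤ s) (hs : ⟪b, e⟫ ≤ s) :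
    volume (gained e s E) = 0 := by
  have hcont := continuous_volume_gained he hE hv
  have hdich : ∀ t, s ≤ t → volume (gained e t E) = 0 ∨ η ≤ volume (gained e t E) := by
    intro t ht
    by_cases hd : volume (dominant e t E) = 0
    · refine Or.inl (volume_gained_eq_zero he t hE hR hd ?_)
      rw [hb]
      exact mul_nonpos_of_nonneg_of_nonpos ENNReal.toReal_nonneg (by linarith)
    · by_cases hg : volume (gained e t E) = 0
      · exact Or.inl hg
      · exact Or.inr (hno t (hs0.trans ht) (pos_iff_ne_zero.2 hg) (pos_iff_ne_zero.2 hd))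
  by_contra hne
  have hge : η ≤ volume (gained e s E) := (hdich s le_rfl).resolve_left hne
  set T := max s R
  have hT : volume (gained e T E) = 0 := by
    convert measure_empty (μ := volume) using 2
    refine Set.eq_empty_of_forall_notMem ?_
    rintro x ⟨h1, h2, h3⟩
    have h4 := hR h3
    rw [mem_ball_zero_iff] at h4
    have h5 := real_inner_le_norm (refl e T x) e
    rw [inner_refl he, he, mul_one] at h5
    have : R ≤ T := le_max_right _ _
    linarith
  obtain ⟨η', h1, h2⟩ := exists_between hη
  have hmem : η' ∈ Set.Icc (volume (gained e T E)) (volume (gained e s E)) :=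
    ⟨by rw [hT]; exact bot_le, h2.le.trans hge⟩
  obtain ⟨t, ht, hte⟩ := intermediate_value_Icc' (le_max_left s R) hcont.continuousOn hmem
  simp only at hte
  rcases hdich t ht.1 with h | h
  · rw [h] at hte
    exact h1.ne hte
  · rw [hte] at h
    exact absurd h2 (not_lt.2 h)

theorem volume_gained_eq_zero_of_reflected {e : Eu N} (he : ‖e‖ = 1) {β s : ℝ}
    {E : Set (Eu N)} (hsymm : ∀ᵐ x, (refl e β x ∈ E ↔ x ∈ E))
    (h : volume (gained (-e) (s - 2 * β) E) = 0) : volume (gained e s E) = 0 := by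
  have hσ := (measurePreserving_refl he β).quasiMeasurePreserving
  have hτ := (measurePreserving_refl he s).quasiMeasurePreserving
  have h' : ∀ᵐ x, x ∉ gained (-e) (s - 2 * β) E := measure_eq_zero_iff_ae_notMem.1 h
  rw [measure_eq_zero_iff_ae_notMem]
  filter_upwards [hσ.ae h', hsymm, hτ.ae hsymm] with x h1 h2 h3
  rintro ⟨h4, h5, h6⟩
  refine h1 ⟨?_, ?_, ?_⟩
  · rw [inner_neg_right, inner_refl he]; linarith
  · rwa [h2]
  · rwa [refl_refl_comm he, h3]

/-- A nearly spherical set that is not a unit ball can be perturbed slightly so as to increase its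
energy. -/
theorem exists_energy_lt (hN : 2 ≤ N) {a : ℝ} (ha0 : 0 < a) (ha : a < N) {r R : ℝ}
    {E : Set (Eu N)} (hE : MeasurableSet E) (hv : volume E = volume (ball (0 : Eu N) 1))
    (hr : ball 0 r ⊆ E) (hR : E ⊆ ball 0 R)
    (hne : ∀ x : Eu N, volume (ball x 1 ∆ E) ≠ 0) {η : ℝ≥0∞} (hη : 0 < η) :
    ∃ G : Set (Eu N), MeasurableSet G ∧ volume G = volume (ball (0 : Eu N) 1) ∧
      ball 0 r ⊆ G ∧ G ⊆ ball 0 R ∧ volume (G ∆ E) < η ∧ energy a E < energy a G := by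
  by_contra! hcon
  have hvt : volume E < ⊤ := hv ▸ volume_ball_lt_top _ _
  have hv0 : 0 < volume E := hv ▸ measure_ball_pos _ _ one_pos
  obtain ⟨b, hb⟩ := exists_barycenter hv0 hvt hR
  have hno : ∀ e : Eu N, ‖e‖ = 1 → ∀ s, 0 ≤ s → 0 < volume (gained e s E) →
      0 < volume (dominant e s E) → η / 2 ≤ volume (gained e s E) := by
    intro e he s hs hg hd
    by_contra! hlt
    refine absurd (energy_lt_polarize hN ha0 ha he s hE hvt hg hd) (not_lt.2 ?_)
    refine hcon _ (measurableSet_polarize e s hE) ((volume_polarize he s hE).trans hv)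
      (ball_subset_polarize he hs hr) (polarize_subset_ball he hs hR) ?_
    refine (volume_symmDiff_polarize_le he s hE).trans_lt ?_
    rw [mul_comm]
    exact (ENNReal.lt_div_iff_mul_lt (by simp) (by simp)).1 hlt
  have hη2 : 0 < η / 2 := ENNReal.div_pos hη.ne' (by simp)
  have hzero : ∀ e : Eu N, ‖e‖ = 1 → ∀ s, 0 ≤ s → ⟪b, e⟫ ≤ s → volume (gained e s E) = 0 :=
    fun e he s hs0 hs => volume_gained_eq_zero_of_forall he hE hvt hR hb hη2 (hno e he) hs0 hs
  have hall : ∀ e : Eu N, ‖e‖ = 1 → ∀ s, ⟪b, e⟫ ≤ s → volume (gained e s E) = 0 := by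
    intro e he s hs
    rcases le_total 0 (⟪b, e⟫) with h0 | h0
    · exact hzero e he s (h0.trans hs) hs
    · have he' : ‖-e‖ = 1 := by simpa using he
      have hg : volume (gained (-e) (-⟪b, e⟫) E) = 0 :=
        hzero (-e) he' _ (by linarith) (by rw [inner_neg_right])
      have hd : volume (dominant (-e) (-⟪b, e⟫) E) = 0 :=
        volume_dominant_eq_zero he' _ hE hR hg (by rw [hb, inner_neg_right]; simp)
      have hsymm := ae_mem_iff_refl_mem he' hg hd
      rw [refl_neg] at hsymm
      exact volume_gained_eq_zero_of_reflected he hsymm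
        (hzero (-e) he' _ (by linarith) (by rw [inner_neg_right]; linarith))
  obtain ⟨c, hc0, -, hc⟩ := exists_refl_volume_ge hN (R + ‖b‖)
  have hBm : MeasurableSet (ball b 1) := measurableSet_ball
  have hadd : MeasurePreserving (fun y : Eu N => y + b) volume volume :=
    measurePreserving_add_right volume b
  obtain ⟨e, s, he, hs, hge⟩ := hc ((fun y => y + b) ⁻¹' (E \ ball b 1))
    ((fun y => y + b) ⁻¹' (ball b 1 \ E)) (hadd.measurable (hE.diff hBm))
    (hadd.measurable (hBm.diff hE)) (fun y hy => by
      have h1 := hR hy.1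
      rw [mem_ball_zero_iff] at h1 ⊢
      have h2 := norm_sub_le (y + b) b
      rw [add_sub_cancel_right] at h2
      linarith) (fun x hx y hy => by
      have h1 := hx.2
      have h2 := hy.1
      rw [mem_ball_iff_norm, add_sub_cancel_right] at h1 h2
      linarith)
  rw [hadd.measure_preimage (hE.diff hBm).nullMeasurableSet,
    hadd.measure_preimage (hBm.diff hE).nullMeasurableSet] at hge
  have hvb : volume (ball b 1) = volume E := by
    rw [hv, Measure.addHaar_ball_center volume b 1]
  have hsd := volume_symmDiff_eq hE hBm hvb.symm hvt
  have hdd := measure_sdiff_comm hE hBm hvb.symm hvt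
  have hpos : volume (E \ ball b 1) ≠ 0 := by
    intro h
    rw [h, mul_zero, symmDiff_comm] at hsd
    exact hne b hsd
  have hpos2 : 0 < c * volume (E \ ball b 1) * volume (ball b 1 \ E) := by
    rw [← hdd]
    exact pos_iff_ne_zero.2 (mul_ne_zero (mul_ne_zero hc0.ne' hpos) hpos)
  refine absurd (hpos2.trans_le hge) (not_lt.2 (le_of_eq ?_))
  have hnull := hall e he (s + ⟪b, e⟫) (by linarith)
  have hmp := (measurePreserving_refl he (s + ⟪b, e⟫)).comp hadd
  refine measure_mono_null (fun y hy => ?_) ((hmp.measure_preimage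
    (measurableSet_gained e (s + ⟪b, e⟫) hE).nullMeasurableSet).trans hnull)
  obtain ⟨⟨h1, h2⟩, ⟨h3, h4⟩⟩ := hy
  have hr1 : refl e (s + ⟪b, e⟫) (y + b) = refl e s y + b := by
    rw [refl, refl, inner_add_left]
    module
  rw [mem_ball_iff_norm, add_sub_cancel_right] at h2 h3
  have h5 : s < ⟪y, e⟫ := by
    have h6 := norm_sq_refl he s y
    have h7 := pow_lt_pow_left₀ (h3.trans_le (not_lt.1 h2)) (norm_nonneg _) two_ne_zero
    by_contra h8
    nlinarith
  show refl e (s + ⟪b, e⟫) (y + b) ∈ gained e (s + ⟪b, e⟫) E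
  refine ⟨?_, ?_, ?_⟩
  · rw [inner_refl he, inner_add_left]; linarith
  · rw [hr1]; exact h4
  · rw [refl_refl he]; exact h1

theorem continuous_volume_inter_ball (hN : 2 ≤ N) {S : Set (Eu N)} (hv : volume S < ⊤) :
    Continuous fun r : ℝ => volume (S ∩ ball 0 r) := by
  have hN' : Nontrivial (Eu N) := by
    have : Nonempty (Fin N) := ⟨⟨0, by omega⟩⟩
    infer_instance
  refine continuous_iff_continuousAt.2 fun r' => ?_
  set d : ℝ → ℝ≥0∞ := fun r => volume (S ∩ {x | ‖x‖ ∈ Set.Icc (r' - |r - r'|) (r' + |r - r'|)})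
  have h3 : Filter.Tendsto d (nhds r') (nhds 0) := by
    have hmi : Measurable fun x : Eu N => ‖x‖ := by fun_prop
    set μ : Measure ℝ := (volume.restrict S).map (fun x => ‖x‖) with hμ
    have hfin : IsFiniteMeasure (volume.restrict S) := ⟨by rwa [Measure.restrict_apply_univ]⟩
    have hfin2 : IsFiniteMeasure μ := Measure.isFiniteMeasure_map _ _
    have hna : NullSingletonClass μ := ⟨fun t => by
      rw [hμ, Measure.map_apply hmi (measurableSet_singleton t)]
      refine le_antisymm ((Measure.restrict_apply_le _ _).trans_eq ?_) bot_le
      convert Measure.addHaar_sphere volume (0 : Eu N) t using 2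
      ext x
      simp⟩
    have h3 := (tendsto_measure_Icc μ r').comp
      (show Filter.Tendsto (fun s => |s - r'|) (nhds r') (nhds 0) by
        have : Continuous fun s => |s - r'| := by fun_prop
        simpa using this.tendsto r')
    refine h3.congr fun s => ?_
    rw [Function.comp_apply, hμ, Measure.map_apply hmi measurableSet_Icc,
      Measure.restrict_apply (hmi measurableSet_Icc), Set.inter_comm]
    rfl
  have hfin : volume (S ∩ ball 0 r') ≠ ⊤ := measure_ne_top_of_subset Set.inter_subset_left hv.ne
  refine tendsto_of_tendsto_of_tendsto_of_le_of_le (g := fun s => volume (S ∩ ball 0 r') - d s)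
    (h := fun s => volume (S ∩ ball 0 r') + d s) ?_ ?_ (fun s => ?_) (fun s => ?_)
  · simpa using ENNReal.Tendsto.sub (tendsto_const_nhds (x := volume (S ∩ ball 0 r'))) h3
      (Or.inl hfin)
  · simpa using h3.const_add (volume (S ∩ ball 0 r'))
  · refine tsub_le_iff_right.2 ((measure_mono fun x hx => ?_).trans (measure_union_le _ _))
    by_cases h : x ∈ ball 0 s
    · exact Or.inl ⟨hx.1, h⟩
    · refine Or.inr ⟨hx.1, ?_⟩
      have h1 := hx.2
      rw [mem_ball_zero_iff] at h h1
      have := neg_abs_le (s - r')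
      have := abs_nonneg (s - r')
      exact ⟨by linarith, by linarith⟩
  · refine (measure_mono fun x hx => ?_).trans (measure_union_le _ _)
    by_cases h : x ∈ ball 0 r'
    · exact Or.inl ⟨hx.1, h⟩
    · refine Or.inr ⟨hx.1, ?_⟩
      have h1 := hx.2
      rw [mem_ball_zero_iff] at h h1
      have := le_abs_self (s - r')
      have := abs_nonneg (s - r')
      exact ⟨by linarith, by linarith⟩

/-- The volume of a nearly spherical set can be corrected by adding or removing part of it. -/
theorem exists_volume_eq (hN : 2 ≤ N) {κ : ℝ} (hκ0 : 0 ≤ κ) {E : Set (Eu N)}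
    (hE : MeasurableSet E) (hr : ball 0 (1 - κ) ⊆ E) (hR : E ⊆ ball 0 (1 + κ)) :
    ∃ G : Set (Eu N), MeasurableSet G ∧ volume G = volume (ball (0 : Eu N) 1) ∧
      ball 0 (1 - κ) ⊆ G ∧ G ⊆ ball 0 (1 + κ) ∧ (G ⊆ E ∨ E ⊆ G) := by
  have hEt : volume E < ⊤ := (measure_mono hR).trans_lt (volume_ball_lt_top _ _)
  rcases le_total (volume E) (volume (ball (0 : Eu N) 1)) with h | h
  · set S := Eᶜ ∩ ball (0 : Eu N) 2
    have hSm : MeasurableSet S := hE.compl.inter measurableSet_ball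
    have hSt : volume S < ⊤ := (measure_mono Set.inter_subset_right).trans_lt (volume_ball_lt_top _ _)
    have hdisj (r : ℝ) : Disjoint E (S ∩ ball 0 r) :=
      Set.disjoint_left.2 fun x h1 h2 => h2.1.1 h1
    have hvol (r : ℝ) : volume (E ∪ (S ∩ ball 0 r)) = volume E + volume (S ∩ ball 0 r) :=
      measure_union (hdisj r) (hSm.inter measurableSet_ball)
    have hc : Continuous fun r : ℝ => volume E + volume (S ∩ ball 0 r) :=
      continuous_const.add (continuous_volume_inter_ball hN hSt)
    obtain ⟨r, hr01, hre⟩ := intermediate_value_Icc (zero_le_one' ℝ) hc.continuousOn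
      (show volume (ball (0 : Eu N) 1) ∈ Set.Icc _ _ from ⟨by simpa using h, by
        rw [← hvol]
        refine measure_mono fun x hx => ?_
        by_cases hxE : x ∈ E
        · exact Or.inl hxE
        · exact Or.inr ⟨⟨hxE, ball_subset_ball one_le_two hx⟩, hx⟩⟩)
    simp only at hre
    refine ⟨E ∪ (S ∩ ball 0 r), hE.union (hSm.inter measurableSet_ball), by rw [hvol, hre],
      hr.trans Set.subset_union_left, Set.union_subset hR ?_, Or.inr Set.subset_union_left⟩
    exact Set.inter_subset_right.trans (ball_subset_ball (by linarith [hr01.2]))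
  · obtain ⟨r, hr01, hre⟩ := intermediate_value_Icc (show (1 : ℝ) ≤ 1 + κ by linarith)
      (continuous_volume_inter_ball hN hEt).continuousOn
      (show volume (ball (0 : Eu N) 1) ∈ Set.Icc _ _ from
        ⟨measure_mono Set.inter_subset_right, by rwa [Set.inter_eq_left.2 hR]⟩)
    refine ⟨E ∩ ball 0 r, hE.inter measurableSet_ball, hre, Set.subset_inter hr
      (ball_subset_ball (by linarith [hr01.1])), Set.inter_subset_left.trans hR,
      Or.inl Set.inter_subset_left⟩

theorem volume_symmDiff_le_of_subset {E F G : Set (Eu N)} (hE : MeasurableSet E)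
    (hF : MeasurableSet F) (hG : MeasurableSet G) (hv : volume G = volume E) (hEt : volume E < ⊤)
    (hFt : volume F < ⊤) (h : G ⊆ F ∨ F ⊆ G) : volume (G ∆ E) ≤ 2 * volume (F ∆ E) := by
  refine (measure_symmDiff_le G F E).trans ?_
  rw [two_mul]
  refine add_le_add ?_ le_rfl
  have h1 := measure_inter_add_sdiff (μ := volume) E hF
  have h2 := measure_inter_add_sdiff (μ := volume) F hE
  have hI : volume (E ∩ F) ≠ ⊤ := measure_ne_top_of_subset Set.inter_subset_left hEt.ne
  have h3 : volume (F \ E) ≤ volume (F ∆ E) := measure_mono Set.subset_union_left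
  have h4 : volume (E \ F) ≤ volume (F ∆ E) := measure_mono Set.subset_union_right
  rcases h with h | h
  · have h5 := measure_sdiff_add_inter (μ := volume) F hG
    rw [Set.inter_eq_right.2 h, hv] at h5
    rw [symmDiff_of_le (show G ≤ F from h)]
    refine le_trans ?_ h3
    rw [Set.inter_comm] at h2
    rw [← ENNReal.add_le_add_iff_right hEt.ne, h5, ← h2, add_comm]
    gcongr
    exact Set.inter_subset_left
  · have h5 := measure_sdiff_add_inter (μ := volume) G hF
    rw [Set.inter_eq_right.2 h, hv] at h5
    rw [symmDiff_of_ge (show F ≤ G from h)]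
    refine le_trans ?_ h4
    rw [← ENNReal.add_le_add_iff_right hFt.ne, h5, ← h1, add_comm]
    gcongr
    exact Set.inter_subset_right

/-- A nearly spherical set is close to sets lying in strictly thinner annuli around the sphere. -/
theorem exists_truncation (hN : 2 ≤ N) {ε : ℝ} (hε0 : 0 < ε) (hε : ε ≤ 1) {E : Set (Eu N)}
    (hE : MeasurableSet E) (hv : volume E = volume (ball (0 : Eu N) 1))
    (hr : ball 0 (1 - ε) ⊆ E) (hR : E ⊆ ball 0 (1 + ε)) {η : ℝ≥0∞} (hη : 0 < η) :
    ∃ κ : ℝ, 0 < κ ∧ κ < ε ∧ ∃ G : Set (Eu N), MeasurableSet G ∧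
      volume G = volume (ball (0 : Eu N) 1) ∧ ball 0 (1 - κ) ⊆ G ∧ G ⊆ ball 0 (1 + κ) ∧
      volume (G ∆ E) < η := by
  set v : ℝ → ℝ≥0∞ := fun r => volume (ball (0 : Eu N) 2 ∩ ball 0 r) with hvdef
  have hvc : Continuous v := continuous_volume_inter_ball hN (volume_ball_lt_top _ _)
  have hvt (r) : v r ≠ ⊤ :=
    measure_ne_top_of_subset Set.inter_subset_left (volume_ball_lt_top _ _).ne
  have hvb {r : ℝ} (h : r ≤ 2) : v r = volume (ball (0 : Eu N) r) := by
    rw [hvdef]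
    simp only [Set.inter_eq_right.2 (ball_subset_ball h)]
  have hlim : Filter.Tendsto (fun t => 2 * ((v (1 - t) - v (1 - ε)) + (v (1 + ε) - v (1 + t))))
      (nhds ε) (nhds 0) := by
    have h1 : Filter.Tendsto (fun t => v (1 - t)) (nhds ε) (nhds (v (1 - ε))) :=
      (show Continuous fun t => v (1 - t) by fun_prop).tendsto ε
    have h2 : Filter.Tendsto (fun t => v (1 + t)) (nhds ε) (nhds (v (1 + ε))) :=
      (show Continuous fun t => v (1 + t) by fun_prop).tendsto ε
    have h3 := ENNReal.Tendsto.sub h1 (tendsto_const_nhds (x := v (1 - ε))) (Or.inl (hvt _))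
    have h4 := ENNReal.Tendsto.sub (tendsto_const_nhds (x := v (1 + ε))) h2 (Or.inl (hvt _))
    have h5 := ENNReal.Tendsto.const_mul (a := 2) (h3.add h4) (Or.inr (by simp))
    simpa using h5
  have hev := (hlim.eventually (gt_mem_nhds hη)).filter_mono (nhdsWithin_le_nhds (s := Set.Iio ε))
  obtain ⟨κ, hκ, hκε⟩ := (hev.and (Ioo_mem_nhdsLT hε0)).exists
  refine ⟨κ, hκε.1, hκε.2, ?_⟩
  set F := (E ∪ ball 0 (1 - κ)) ∩ ball 0 (1 + κ)
  have hFm : MeasurableSet F := (hE.union measurableSet_ball).inter measurableSet_ball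
  obtain ⟨G, hGm, hGv, hGr, hGR, hGF⟩ := exists_volume_eq hN hκε.1.le hFm
    (Set.subset_inter Set.subset_union_right (ball_subset_ball (by linarith [hκε.1])))
    Set.inter_subset_right
  refine ⟨G, hGm, hGv, hGr, hGR, ?_⟩
  have hEt : volume E < ⊤ := hv ▸ volume_ball_lt_top _ _
  have hFt : volume F < ⊤ := (measure_mono Set.inter_subset_right).trans_lt (volume_ball_lt_top _ _)
  refine (volume_symmDiff_le_of_subset hE hFm hGm (hGv.trans hv.symm) hEt hFt hGF).trans_lt
    (lt_of_le_of_lt ?_ hκ)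
  gcongr
  have hsub : F ∆ E ⊆ (ball 0 (1 - κ) \ ball 0 (1 - ε)) ∪ (ball 0 (1 + ε) \ ball 0 (1 + κ)) := by
    rintro x (⟨⟨h1 | h1, h2⟩, h3⟩ | ⟨h1, h2⟩)
    · exact absurd h1 h3
    · exact Or.inl ⟨h1, fun h => h3 (hr h)⟩
    · exact Or.inr ⟨hR h1, fun h => h2 ⟨Or.inl h1, h⟩⟩
  refine (measure_mono hsub).trans ((measure_union_le _ _).trans ?_)
  have hκ2 := hκε.2
  rw [hvb (by linarith [hκε.1]), hvb (by linarith), hvb (by linarith), hvb (by linarith),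
    measure_sdiff (ball_subset_ball (by linarith)) measurableSet_ball.nullMeasurableSet
      (volume_ball_lt_top _ _).ne,
    measure_sdiff (ball_subset_ball (by linarith)) measurableSet_ball.nullMeasurableSet
      (volume_ball_lt_top _ _).ne]

theorem exists_annulus_small (hN : 2 ≤ N) {m : ℝ≥0∞} (hm : 0 < m) :
    ∃ ε : ℝ, 0 < ε ∧ ε ≤ 1 / 4 ∧ volume (ball (0 : Eu N) (1 + ε) \ ball 0 (1 - ε)) < m := by
  set v : ℝ → ℝ≥0∞ := fun r => volume (ball (0 : Eu N) 2 ∩ ball 0 r) with hvdef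
  have hvc : Continuous v := continuous_volume_inter_ball hN (volume_ball_lt_top _ _)
  have hvt (r) : v r ≠ ⊤ :=
    measure_ne_top_of_subset Set.inter_subset_left (volume_ball_lt_top _ _).ne
  have hvb {r : ℝ} (h : r ≤ 2) : v r = volume (ball (0 : Eu N) r) := by
    rw [hvdef]
    simp only [Set.inter_eq_right.2 (ball_subset_ball h)]
  have hlim : Filter.Tendsto (fun t => v (1 + t) - v (1 - t)) (nhds 0) (nhds 0) := by
    have h1 : Filter.Tendsto (fun t => v (1 - t)) (nhds 0) (nhds (v (1 - 0))) :=
      (show Continuous fun t => v (1 - t) by fun_prop).tendsto 0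
    have h2 : Filter.Tendsto (fun t => v (1 + t)) (nhds 0) (nhds (v (1 + 0))) :=
      (show Continuous fun t => v (1 + t) by fun_prop).tendsto 0
    simpa using ENNReal.Tendsto.sub h2 h1 (Or.inl (hvt _))
  have hev := (hlim.eventually (gt_mem_nhds hm)).filter_mono (nhdsWithin_le_nhds (s := Set.Ioi 0))
  obtain ⟨ε, h1, h2⟩ := (hev.and (Ioo_mem_nhdsGT (show (0 : ℝ) < 1 / 4 by norm_num))).exists
  have h3 := h2.1
  have h4 := h2.2
  refine ⟨ε, h3, h4.le, ?_⟩
  rwa [hvb (by linarith), hvb (by linarith), ← measure_sdiff (ball_subset_ball (by linarith))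
    measurableSet_ball.nullMeasurableSet (volume_ball_lt_top _ _).ne] at h1

theorem rpow_neg_add_le {a u v : ℝ} (ha : 0 < a) (hu : 0 < u) (hv : 0 < v) :
    v ^ (-a) + a * v ^ (-a - 1) * (v - u) ≤ u ^ (-a) := by
  have h1 : 1 - a * (u / v - 1) ≤ (u / v) ^ (-a) := by
    rw [Real.rpow_def_of_pos (div_pos hu hv)]
    have h2 := Real.add_one_le_exp (Real.log (u / v) * -a)
    have h3 := Real.log_le_sub_one_of_pos (div_pos hu hv)
    nlinarith
  rw [Real.div_rpow hu.le hv.le, le_div_iff₀ (Real.rpow_pos_of_pos hv _)] at h1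
  refine le_trans (le_of_eq ?_) h1
  rw [Real.rpow_sub_one hv.ne']
  field_simp
  ring

theorem kernel_le_add {a : ℝ} (ha : 0 < a) (p q y : Eu N) :
    kernel a p y ≤ kernel a q y + ENNReal.ofReal (a * ‖p - q‖) * kernel (a + 1) p y := by
  rcases eq_or_ne p q with rfl | hpq
  · exact le_self_add
  rcases eq_or_ne q y with rfl | hq
  · have : kernel a q q = ⊤ := by simp [kernel, ha]
    simp [this]
  have hd : 0 < ‖p - q‖ := norm_pos_iff.2 (sub_ne_zero.2 hpq)
  rcases eq_or_ne p y with rfl | hp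
  · have : kernel (a + 1) p p = ⊤ := by
      rw [kernel, sub_self, enorm_zero, ENNReal.zero_rpow_of_neg (by linarith)]
    rw [this, ENNReal.mul_top (by simpa using mul_pos ha hd)]
    simp
  have hu : 0 < ‖p - y‖ := norm_pos_iff.2 (sub_ne_zero.2 hp)
  have hv : 0 < ‖q - y‖ := norm_pos_iff.2 (sub_ne_zero.2 hq)
  rw [kernel_eq_ofReal hp, kernel_eq_ofReal hq, kernel_eq_ofReal hp,
    ← ENNReal.ofReal_mul (by positivity), ← ENNReal.ofReal_add (by positivity) (by positivity)]
  refine ENNReal.ofReal_le_ofReal ?_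
  have h1 := rpow_neg_add_le ha hv hu
  have h2 : ‖q - y‖ - ‖p - y‖ ≤ ‖p - q‖ := by
    have := norm_sub_norm_le (q - y) (p - y)
    rwa [sub_sub_sub_cancel_right, norm_sub_rev q p] at this
  have h3 : 0 < ‖p - y‖ ^ (-a - 1) := by positivity
  rw [neg_add']
  have h4 := mul_le_mul_of_nonneg_left h2 (mul_pos ha h3).le
  linarith

theorem kernel_add_le {a c r d : ℝ} (ha : 0 < a) (hc : 0 < c) (hd : 0 ≤ d) {p q y : Eu N}
    (hp : p ≠ y) (hr : ‖q - y‖ ≤ r) (h : ‖p - y‖ + c * d ≤ ‖q - y‖) :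
    kernel a q y + ENNReal.ofReal (a * r ^ (-a - 1) * c * d) ≤ kernel a p y := by
  have hu : 0 < ‖p - y‖ := norm_pos_iff.2 (sub_ne_zero.2 hp)
  have hv : 0 < ‖q - y‖ := by nlinarith
  have hr0 : 0 < r := hv.trans_le hr
  have hq : q ≠ y := sub_ne_zero.1 (norm_pos_iff.1 hv)
  rw [kernel_eq_ofReal hp, kernel_eq_ofReal hq, ← ENNReal.ofReal_add (by positivity) (by positivity)]
  refine ENNReal.ofReal_le_ofReal ((add_le_add le_rfl ?_).trans (rpow_neg_add_le ha hu hv))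
  have h1 : r ^ (-a - 1) ≤ ‖q - y‖ ^ (-a - 1) :=
    Real.rpow_le_rpow_of_nonpos hv hr (by linarith)
  rw [mul_assoc]
  have h2 : 0 ≤ c * d := by positivity
  gcongr
  linarith

set_option maxHeartbeats 1000000 in
/-- The potential of a nearly spherical set decreases at a linear rate along rays near the unit
sphere. -/
theorem exists_potential_radial (hN : 2 ≤ N) {a : ℝ} (ha0 : 0 < a) (ha : a + 1 < N) :
    ∃ ε₁ c : ℝ, 0 < ε₁ ∧ ε₁ ≤ 1 / 4 ∧ 0 < c ∧ ∀ E : Set (Eu N), MeasurableSet E →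
      ball 0 (1 - ε₁) ⊆ E → E ⊆ ball 0 (1 + ε₁) → ∀ e : Eu N, ‖e‖ = 1 → ∀ t₁ t₂ : ℝ,
      1 - ε₁ ≤ t₁ → t₁ ≤ t₂ → t₂ ≤ 1 + ε₁ →
      potential a E (t₂ • e) + ENNReal.ofReal (c * (t₂ - t₁)) ≤ potential a E (t₁ • e) := by
  set w := volume (ball (0 : Eu N) (1 / 4)) with hw
  have hwt : w < ⊤ := volume_ball_lt_top _ _
  have hN' : Nontrivial (Eu N) := by
    have : Nonempty (Fin N) := ⟨⟨0, by omega⟩⟩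
    infer_instance
  have hw0 : 0 < w.toReal := ENNReal.toReal_pos (measure_ball_pos volume _ (by norm_num)).ne' hwt.ne
  set c₀ : ℝ := a * 3 ^ (-a - 1) * (2 / 5) with hc₀
  have hc₀0 : 0 < c₀ := by positivity
  set η : ℝ := c₀ * w.toReal / (4 * a) with hη
  have hη0 : 0 < η := by positivity
  obtain ⟨m, hm, hsmall⟩ := exists_potential_small hN (show 0 < a + 1 by linarith) ha
    (ENNReal.ofReal_pos.2 hη0)
  obtain ⟨ε, hε0, hε, hann⟩ := exists_annulus_small hN hm
  refine ⟨ε, c₀ * w.toReal / 4, hε0, hε, by positivity, fun E hE hr hR e he t₁ t₂ h1 h12 h2 => ?_⟩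
  set A := ball (0 : Eu N) (1 + ε) \ ball 0 (1 - ε) with hA
  have hAm : MeasurableSet A := measurableSet_ball.diff measurableSet_ball
  set p := t₁ • e with hp
  set q := t₂ • e with hq
  set d := t₂ - t₁ with hd
  have hd0 : 0 ≤ d := sub_nonneg.2 h12
  set s := (t₁ + t₂) / 2 with hs
  have hpe : ⟪p, e⟫ = t₁ := by
    rw [hp, inner_smul_left, real_inner_self_eq_norm_sq, he]; simp
  have hqe : ⟪q, e⟫ = t₂ := by
    rw [hq, inner_smul_left, real_inner_self_eq_norm_sq, he]; simp
  have hσ : refl e s p = q := by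
    rw [refl, hpe, hp, hq, ← sub_smul, hs]; congr 1; ring
  have hσ' : refl e s q = p := by rw [← hσ, refl_refl he]
  have hpq : ‖p - q‖ = d := by
    rw [hp, hq, ← sub_smul, norm_smul, he, mul_one, Real.norm_eq_abs, abs_sub_comm,
      abs_of_nonneg hd0]
  obtain ⟨y₀, hy₀⟩ : ∃ y₀ : Eu N, y₀ = (-1 / 2 : ℝ) • e := ⟨_, rfl⟩
  have hy₀n : ‖y₀‖ = 1 / 2 := by
    rw [hy₀, norm_smul, he]
    norm_num
  have hy₀e : ⟪y₀, e⟫ = -1 / 2 := by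
    rw [hy₀, inner_smul_left, real_inner_self_eq_norm_sq, he]
    simp
  set Y := ball y₀ (1 / 4) with hY
  have hYv : volume Y = w := Measure.addHaar_ball_center volume _ _
  have hpot (x : Eu N) : potential a E x = ∫⁻ y, ind E y * kernel a x y := by
    rw [potential, ← lintegral_indicator hE]
    refine lintegral_congr fun y => ?_
    by_cases h : y ∈ E <;> simp [ind, h]
  have hpot' (x : Eu N) : ∫⁻ y, ind A y * kernel (a + 1) x y ≤ ENNReal.ofReal η := by
    refine le_trans (le_of_eq ?_) (hsmall A hann x)
    rw [← lintegral_indicator hAm]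
    refine lintegral_congr fun y => ?_
    by_cases h : y ∈ A <;> simp [ind, h]
  have hmeas (x : Eu N) : Measurable fun y => ind E y * kernel a x y :=
    (measurable_ind hE).mul (measurable_kernel_right a x)
  have hmeas' (x : Eu N) : Measurable fun y => ind A y * kernel (a + 1) x y :=
    (measurable_ind hAm).mul (measurable_kernel_right _ x)
  have key (y : Eu N) (hyp : y ≠ p) : (ind E y * kernel a q y + ind E (refl e s y) * kernel a p y)
      + ENNReal.ofReal (c₀ * d) * ind Y y ≤
      (ind E y * kernel a p y + ind E (refl e s y) * kernel a q y) +
      ENNReal.ofReal (a * d) * (ind A y * kernel (a + 1) p y + ind A y * kernel (a + 1) q y) := by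
    have hns := norm_sq_refl he s y
    have hs0 : 3 / 4 ≤ s := by linarith
    by_cases hyY : y ∈ Y
    · have hyn : ‖y - y₀‖ < 1 / 4 := mem_ball_iff_norm.1 hyY
      have hye : ⟪y, e⟫ ≤ -1 / 4 := by
        have h3 := real_inner_le_norm (y - y₀) e
        rw [inner_sub_left, hy₀e, he] at h3
        linarith
      have hyn1 : ‖y‖ < 3 / 4 := by
        have h3 := norm_le_norm_sub_add y y₀
        linarith
      have hyE : y ∈ E := hr (by rw [mem_ball_zero_iff]; linarith)
      have hσE : refl e s y ∉ E := fun h => by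
        have h3 := mem_ball_zero_iff.1 (hR h)
        have h6 := mul_nonneg (sub_nonneg.2 hs0) (show 0 ≤ s - ⟪y, e⟫ by linarith)
        have h7 := pow_le_pow_left₀ (norm_nonneg _) h3.le 2
        nlinarith [sq_nonneg ‖y‖]
      rw [ind_of_mem hyE, ind_of_notMem hσE, ind_of_mem hyY]
      simp only [one_mul, zero_mul, add_zero, mul_one]
      refine (kernel_add_le (q := q) ha0 (c := 2 / 5) (r := 3) (d := d) (by norm_num)
        hd0 hyp.symm ?_ ?_).trans le_self_add
      · refine (norm_sub_le _ _).trans ?_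
        rw [hq, norm_smul, he, Real.norm_eq_abs, abs_of_nonneg (by linarith)]
        linarith
      · have h3 : ‖q - y‖ ^ 2 = ‖p - y‖ ^ 2 + 2 * d * (s - ⟪y, e⟫) := by
          rw [← hσ, ← norm_sub_refl_comm he, norm_sq_sub_refl he, hpe, hs, hd]
          ring
        have h4 : ‖p - y‖ ≤ t₁ + 3 / 4 := by
          refine (norm_sub_le _ _).trans ?_
          rw [hp, norm_smul, he, Real.norm_eq_abs, abs_of_nonneg (by linarith)]
          linarith
        have h5 := norm_nonneg (p - y)
        have hd1 : d ≤ 1 / 2 := by rw [hd]; linarith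
        refine abs_le_of_sq_le_sq' ?_ (norm_nonneg _) |>.2
        rw [h3]
        nlinarith [mul_nonneg hd0 (sub_nonneg.2 h4), mul_nonneg hd0 (sub_nonneg.2 hd1),
          mul_nonneg hd0 (sub_nonneg.2 hye), mul_nonneg hd0 (sub_nonneg.2 hs0)]
    · rw [ind_of_notMem hyY, mul_zero, add_zero]
      by_cases hyE : y ∈ E <;> by_cases hσE : refl e s y ∈ E
      · rw [ind_of_mem hyE, ind_of_mem hσE, add_comm (1 * kernel a q y)]
        exact le_self_add
      · rw [ind_of_mem hyE, ind_of_notMem hσE]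
        simp only [one_mul, zero_mul, add_zero]
        rcases le_total ⟪y, e⟫ s with h | h
        · refine le_trans ?_ le_self_add
          rw [← hσ, ← kernel_refl_comm he]
          refine kernel_refl_le ha0.le he s ?_
          rw [hpe]
          exact mul_nonneg_of_nonpos_of_nonpos (by linarith) (by linarith)
        · have hyA : y ∈ A := by
            refine ⟨hR hyE, fun h3 => hσE (hr ?_)⟩
            rw [mem_ball_zero_iff] at h3 ⊢
            refine lt_of_le_of_lt (abs_le_of_sq_le_sq' ?_ (norm_nonneg _)).2 h3
            have h6 := mul_nonneg (show 0 ≤ s by linarith) (sub_nonneg.2 h)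
            linarith
          rw [ind_of_mem hyA, one_mul, one_mul, ← hpq, norm_sub_rev]
          refine (kernel_le_add ha0 q p y).trans ?_
          gcongr
          exact le_add_self
      · rw [ind_of_notMem hyE, ind_of_mem hσE]
        simp only [one_mul, zero_mul, zero_add]
        rcases le_total s ⟪y, e⟫ with h | h
        · refine le_trans ?_ le_self_add
          rw [← hσ, ← kernel_refl_comm he]
          refine kernel_le_refl ha0.le he s ?_
          rw [hpe]
          exact mul_nonpos_of_nonpos_of_nonneg (by linarith) (by linarith)
        · have hyA : y ∈ A := by
            refine ⟨?_, fun h3 => hyE (hr h3)⟩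
            have h3 := hR hσE
            rw [mem_ball_zero_iff] at h3 ⊢
            refine lt_of_le_of_lt (abs_le_of_sq_le_sq' ?_ (norm_nonneg _)).2 h3
            have h6 := mul_nonneg (show 0 ≤ s by linarith) (sub_nonneg.2 h)
            linarith
          rw [ind_of_mem hyA, one_mul, one_mul, ← hpq]
          refine (kernel_le_add ha0 p q y).trans ?_
          gcongr
          exact le_self_add
      · rw [ind_of_notMem hyE, ind_of_notMem hσE]
        simp
  have hint : ∫⁻ y, ((ind E y * kernel a q y + ind E (refl e s y) * kernel a p y)
      + ENNReal.ofReal (c₀ * d) * ind Y y) ≤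
      ∫⁻ y, ((ind E y * kernel a p y + ind E (refl e s y) * kernel a q y) +
      ENNReal.ofReal (a * d) * (ind A y * kernel (a + 1) p y + ind A y * kernel (a + 1) q y)) := by
    refine lintegral_mono_ae ?_
    filter_upwards [compl_mem_ae_iff.2 (measure_singleton p)] with y hy
    exact key y hy
  have hrefl (x : Eu N) : ∫⁻ y, (ind E y * kernel a x y + ind E (refl e s y) *
      kernel a (refl e s x) y) = 2 * potential a E x := by
    rw [hpot, two_mul_lintegral he s (hmeas x)]
    simp only [kernel_refl_comm he]
  have hσm (x : Eu N) : Measurable fun y => ind E (refl e s y) * kernel a x y :=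
    ((measurable_ind hE).comp (measurable_refl e s)).mul (measurable_kernel_right a x)
  have h3 := hrefl p
  have h4 := hrefl q
  rw [hσ] at h3
  rw [hσ'] at h4
  have hadd (x x' : Eu N) :
      Measurable fun y => ind E y * kernel a x y + ind E (refl e s y) * kernel a x' y :=
    (hmeas x).add (hσm x')
  have hadd' : Measurable fun y => ind A y * kernel (a + 1) p y + ind A y * kernel (a + 1) q y :=
    (hmeas' p).add (hmeas' q)
  rw [lintegral_add_left (hadd q p), lintegral_add_left (hadd p q), h3, h4,
    lintegral_const_mul _ (measurable_ind measurableSet_ball), lintegral_ind measurableSet_ball, hYv,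
    lintegral_const_mul _ hadd', lintegral_add_left (hmeas' p)] at hint
  have hEt : volume E < ⊤ := (measure_mono hR).trans_lt (volume_ball_lt_top _ _)
  have h5 := hint.trans (add_le_add le_rfl (mul_le_mul_right (add_le_add (hpot' p) (hpot' q)) _))
  have hfin (x) : potential a E x ≠ ⊤ := (potential_lt_top hN ha0 (by linarith) hEt x).ne
  rw [← ENNReal.ofReal_toReal (hfin p), ← ENNReal.ofReal_toReal (hfin q),
    ← ENNReal.ofReal_add ENNReal.toReal_nonneg (by positivity)]
  rw [← ENNReal.ofReal_toReal (hfin p), ← ENNReal.ofReal_toReal (hfin q),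
    ← ENNReal.ofReal_toReal hwt.ne, ← ENNReal.ofReal_ofNat 2,
    ← ENNReal.ofReal_mul two_pos.le, ← ENNReal.ofReal_mul two_pos.le,
    ← ENNReal.ofReal_mul (by positivity), ← ENNReal.ofReal_add hη0.le hη0.le,
    ← ENNReal.ofReal_mul (by positivity),
    ← ENNReal.ofReal_add (by positivity) (by positivity),
    ← ENNReal.ofReal_add (by positivity) (by positivity),
    ENNReal.ofReal_le_ofReal_iff (by positivity)] at h5
  refine ENNReal.ofReal_le_ofReal ?_
  have h6 : a * d * (η + η) = c₀ * w.toReal * d / 2 := by rw [hη]; field_simp; ring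
  rw [h6] at h5
  nlinarith

/-- Moving mass to smaller radii increases the integral of a function decreasing at a linear rate,
by at least a multiple of the square of the mass moved. -/
theorem lintegral_add_sq_le {ν : Measure ℝ} {h : ℝ → ℝ≥0∞} {p q u c L : ℝ}
    (hc : 0 ≤ c) (hL : 0 < L)
    (hν : ∀ s t, p ≤ s → s ≤ t → t ≤ q → ν (Set.Ico s t) ≤ ENNReal.ofReal (L * (t - s)))
    (hd : ∀ s t, p ≤ s → s ≤ t → t ≤ q → h t + ENNReal.ofReal (c * (t - s)) ≤ h s)
    {A B : Set ℝ} (hA : MeasurableSet A) (hB : MeasurableSet B) (hAu : A ⊆ Set.Icc u q)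
    (hBu : B ⊆ Set.Ico p u) (hAB : ν A = ν B) (hpu : p ≤ u) (huq : u ≤ q) :
    (∫⁻ t in A, h t ∂ν) + ENNReal.ofReal (c / (4 * L)) * ν A ^ 2 ≤ ∫⁻ t in B, h t ∂ν := by
  have hBt : ν B < ⊤ :=
    (measure_mono hBu).trans_lt ((hν p u le_rfl hpu huq).trans_lt ENNReal.ofReal_lt_top)
  set m := (ν B).toReal with hm
  have hm0 : 0 ≤ m := ENNReal.toReal_nonneg
  have hmB : ν B = ENNReal.ofReal m := (ENNReal.ofReal_toReal hBt.ne).symm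
  have h1 : ∫⁻ t in A, h t ∂ν ≤ h u * ν B := by
    rw [← hAB, ← setLIntegral_const]
    refine setLIntegral_mono' hA fun t ht => ?_
    exact le_self_add.trans (hd u t hpu (hAu ht).1 (hAu ht).2)
  set r := m / (2 * L) with hr
  have hr0 : 0 ≤ r := by positivity
  set B' := B \ Set.Ico (u - r) u with hB'
  have hB'm : MeasurableSet B' := hB.diff measurableSet_Ico
  have h2 : ENNReal.ofReal (m / 2) ≤ ν B' := by
    have h3 : ν (B ∩ Set.Ico (u - r) u) ≤ ENNReal.ofReal (m / 2) := by
      rcases le_total p (u - r) with hp | hp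
      · refine (measure_mono Set.inter_subset_right).trans
          ((hν _ _ hp (by linarith) huq).trans (ENNReal.ofReal_le_ofReal (le_of_eq ?_)))
        rw [hr]
        field_simp
        ring
      · refine (measure_mono (Set.inter_subset_left.trans hBu)).trans
          ((hν _ _ le_rfl hpu huq).trans (ENNReal.ofReal_le_ofReal ?_))
        have h4 : L * (u - p) ≤ L * r := by gcongr; linarith
        refine h4.trans (le_of_eq ?_)
        rw [hr]
        field_simp
    have h4 := measure_inter_add_sdiff (μ := ν) B (measurableSet_Ico (a := u - r) (b := u))
    have h5 : ENNReal.ofReal (m / 2) + ENNReal.ofReal (m / 2) ≤ ENNReal.ofReal (m / 2) + ν B' := by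
      rw [← ENNReal.ofReal_add (by positivity) (by positivity), add_halves, ← hmB, ← h4]
      exact add_le_add h3 le_rfl
    exact (ENNReal.add_le_add_iff_left ENNReal.ofReal_ne_top).1 h5
  have h3 : h u * ν B + ENNReal.ofReal (c * r) * ν B' ≤ ∫⁻ t in B, h t ∂ν := by
    have h4 : h u * ν B + ENNReal.ofReal (c * r) * ν B' =
        ∫⁻ t in B, (h u + B'.indicator (fun _ => ENNReal.ofReal (c * r)) t) ∂ν := by
      rw [lintegral_add_left measurable_const, setLIntegral_const, lintegral_indicator hB'm,
        setLIntegral_const, Measure.restrict_apply hB'm, Set.inter_eq_left.2 Set.sdiff_subset]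
    rw [h4]
    refine setLIntegral_mono' hB fun t ht => ?_
    have h5 := hd t u (hBu ht).1 (hBu ht).2.le huq
    refine le_trans (add_le_add le_rfl ?_) h5
    by_cases htB : t ∈ B'
    · rw [Set.indicator_of_mem htB]
      refine ENNReal.ofReal_le_ofReal (mul_le_mul_of_nonneg_left ?_ hc)
      have h6 : ¬ (u - r ≤ t) := fun h => htB.2 ⟨h, (hBu ht).2⟩
      linarith
    · rw [Set.indicator_of_notMem htB]
      exact bot_le
  refine le_trans (add_le_add h1 ?_) h3
  refine le_trans (le_of_eq ?_) (mul_le_mul_right h2 _)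
  rw [hAB, hmB, ← ENNReal.ofReal_pow hm0, ← ENNReal.ofReal_mul (by positivity),
    ← ENNReal.ofReal_mul (by positivity), hr]
  congr 1
  field_simp
  ring

/-- The measure `t ^ (N - 1) dt` on the positive half-line. -/
noncomputable def radialMeasure (N : ℕ) : Measure ℝ :=
  (volume.restrict (Set.Ioi 0)).withDensity fun t => ENNReal.ofReal (t ^ (N - 1))

theorem lintegral_polar_radialMeasure (hN : 2 ≤ N) {f : Eu N → ℝ≥0∞} (hf : Measurable f) :
    ∫⁻ x, f x = ∫⁻ e, (∫⁻ t, f (t • (e : Eu N)) ∂(radialMeasure N))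
      ∂(volume : Measure (Eu N)).toSphere := by
  rw [lintegral_polar hN hf]
  refine lintegral_congr fun e => ?_
  have hfe : Measurable fun t : ℝ => f (t • (e : Eu N)) := hf.comp (measurable_id.smul_const _)
  rw [radialMeasure, lintegral_withDensity_eq_lintegral_mul _ (by fun_prop) hfe]
  rfl

theorem radialMeasure_Ico (hN : 2 ≤ N) {s t : ℝ} (hs : 0 ≤ s) (hst : s ≤ t) :
    radialMeasure N (Set.Ico s t) = ENNReal.ofReal ((t ^ N - s ^ N) / N) := by
  rw [radialMeasure, withDensity_apply _ measurableSet_Ico, Measure.restrict_restrict measurableSet_Ico]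
  have h1 : (Set.Ico s t ∩ Set.Ioi 0 : Set ℝ) =ᵐ[volume] Set.Ioc s t := by
    have h2 : (Set.Ioo s t : Set ℝ) ≤ᵐ[volume] (Set.Ico s t ∩ Set.Ioi 0 : Set ℝ) :=
      Filter.Eventually.of_forall fun x hx => ⟨⟨hx.1.le, hx.2⟩, lt_of_le_of_lt hs hx.1⟩
    have h3 : (Set.Ico s t ∩ Set.Ioi 0 : Set ℝ) ≤ᵐ[volume] (Set.Ico s t : Set ℝ) :=
      Filter.Eventually.of_forall fun x hx => hx.1
    exact (h3.trans Ico_ae_eq_Ioc.le).antisymm (Ioo_ae_eq_Ioc.symm.le.trans h2)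
  rw [setLIntegral_congr h1, ← ofReal_integral_eq_lintegral_ofReal]
  · rw [← intervalIntegral.integral_of_le hst, integral_pow]
    have h4 : N - 1 + 1 = N := by omega
    rw [h4]
    congr 2
    exact_mod_cast h4
  · exact (intervalIntegrable_iff_integrableOn_Ioc_of_le hst).1
      (Continuous.intervalIntegrable (by fun_prop) _ _)
  · filter_upwards [ae_restrict_mem measurableSet_Ioc] with x hx
    have : 0 ≤ x := hs.trans hx.1.le
    positivity

theorem radialMeasure_Ico_le (N : ℕ) {s t : ℝ} (ht : t ≤ 2) :
    radialMeasure N (Set.Ico s t) ≤ ENNReal.ofReal (2 ^ (N - 1) * (t - s)) := by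
  rw [radialMeasure, withDensity_apply _ measurableSet_Ico, Measure.restrict_restrict measurableSet_Ico]
  calc ∫⁻ x in Set.Ico s t ∩ Set.Ioi 0, ENNReal.ofReal (x ^ (N - 1))
      ≤ ∫⁻ x in Set.Ico s t ∩ Set.Ioi 0, ENNReal.ofReal (2 ^ (N - 1)) := by
        refine setLIntegral_mono' (measurableSet_Ico.inter measurableSet_Ioi) fun x hx => ?_
        exact ENNReal.ofReal_le_ofReal
          (pow_le_pow_left₀ (le_of_lt hx.2) (hx.1.2.le.trans ht) _)
    _ ≤ ENNReal.ofReal (2 ^ (N - 1)) * volume (Set.Ico s t) := by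
        rw [setLIntegral_const]
        gcongr
        exact Set.inter_subset_left
    _ = _ := by rw [Real.volume_Ico, ← ENNReal.ofReal_mul (by positivity)]

theorem ae_radialMeasure_pos (N : ℕ) : ∀ᵐ t ∂(radialMeasure N), 0 < t :=
  (withDensity_absolutelyContinuous _ _).ae_le (ae_restrict_mem measurableSet_Ioi)

instance : SFinite (radialMeasure N) := by
  unfold radialMeasure
  infer_instance

theorem radialMeasure_congr {A B : Set ℝ} (h : ∀ t, 0 < t → (t ∈ A ↔ t ∈ B)) :
    radialMeasure N A = radialMeasure N B := by
  refine measure_congr ?_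
  filter_upwards [ae_radialMeasure_pos N] with t ht
  exact propext (h t ht)

/-- The part of the ray through `x` that lies in `E`, as a set of radii. -/
def raySet (E : Set (Eu N)) (x : Eu N) : Set ℝ := {t | 0 < t ∧ t • x ∈ E}

theorem measurableSet_raySet {E : Set (Eu N)} (hE : MeasurableSet E) (x : Eu N) :
    MeasurableSet (raySet E x) :=
  measurableSet_Ioi.inter ((measurable_id.smul_const x) hE)

theorem measurable_radialMeasure_raySet {E : Set (Eu N)} (hE : MeasurableSet E) :
    Measurable fun x => radialMeasure N (raySet E x) := by
  have hs : MeasurableSet {p : Eu N × ℝ | 0 < p.2 ∧ p.2 • p.1 ∈ E} :=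
    (measurable_snd measurableSet_Ioi).inter ((measurable_snd.smul measurable_fst) hE)
  exact measurable_measure_prodMk_left hs

theorem setLIntegral_polar (hN : 2 ≤ N) {E : Set (Eu N)} (hE : MeasurableSet E)
    {W : Eu N → ℝ≥0∞} (hW : Measurable W) :
    ∫⁻ x in E, W x = ∫⁻ e, (∫⁻ t in raySet E (e : Eu N), W (t • (e : Eu N)) ∂(radialMeasure N))
      ∂(volume : Measure (Eu N)).toSphere := by
  rw [← lintegral_indicator hE, lintegral_polar_radialMeasure hN (hW.indicator hE)]
  refine lintegral_congr fun e => ?_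
  rw [← lintegral_indicator (measurableSet_raySet hE _)]
  refine lintegral_congr_ae ?_
  filter_upwards [ae_radialMeasure_pos N] with t ht
  by_cases h : t • (e : Eu N) ∈ E
  · rw [Set.indicator_of_mem h, Set.indicator_of_mem (show t ∈ raySet E e from ⟨ht, h⟩)]
  · rw [Set.indicator_of_notMem h, Set.indicator_of_notMem fun h' : t ∈ raySet E e => h h'.2]

theorem volume_eq_lintegral_raySet (hN : 2 ≤ N) {E : Set (Eu N)} (hE : MeasurableSet E) :
    volume E = ∫⁻ e : sphere (0 : Eu N) 1, radialMeasure N (raySet E (e : Eu N))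
      ∂(volume : Measure (Eu N)).toSphere := by
  have h := setLIntegral_polar hN hE (measurable_const (a := (1 : ℝ≥0∞)))
  simpa using h

/-- The length in direction `x` after all the mass of `E` on rays has been moved towards the
origin, truncated to `[1 - κ, 1 + κ]`. -/
noncomputable def rayRadius (κ : ℝ) (E : Set (Eu N)) (x : Eu N) : ℝ :=
  max (1 - κ) (min (1 + κ) ((N * (radialMeasure N (raySet E x)).toReal) ^ ((N : ℝ)⁻¹)))

/-- The starshaped set obtained from `E` by moving the mass on each ray towards the origin. -/
noncomputable def starshape (κ : ℝ) (E : Set (Eu N)) : Set (Eu N) :=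
  {y | ‖y‖ < rayRadius κ E (‖y‖⁻¹ • y)}

theorem measurable_rayRadius (κ : ℝ) {E : Set (Eu N)} (hE : MeasurableSet E) :
    Measurable (rayRadius κ E) := by
  have := (measurable_radialMeasure_raySet hE).ennreal_toReal
  unfold rayRadius
  fun_prop

theorem measurableSet_starshape (κ : ℝ) {E : Set (Eu N)} (hE : MeasurableSet E) :
    MeasurableSet (starshape κ E) :=
  measurableSet_lt measurable_norm
    ((measurable_rayRadius κ hE).comp ((measurable_norm.inv).smul measurable_id))

theorem le_rayRadius (κ : ℝ) (E : Set (Eu N)) (x : Eu N) : 1 - κ ≤ rayRadius κ E x :=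
  le_max_left _ _

theorem rayRadius_le {κ : ℝ} (hκ : 0 ≤ κ) (E : Set (Eu N)) (x : Eu N) :
    rayRadius κ E x ≤ 1 + κ :=
  max_le (by linarith) (min_le_left _ _)

theorem ball_subset_starshape (κ : ℝ) (E : Set (Eu N)) : ball 0 (1 - κ) ⊆ starshape κ E :=
  fun _ hy => (mem_ball_zero_iff.1 hy).trans_le (le_rayRadius _ _ _)

theorem starshape_subset_ball {κ : ℝ} (hκ : 0 ≤ κ) (E : Set (Eu N)) :
    starshape κ E ⊆ ball 0 (1 + κ) :=
  fun _ hy => mem_ball_zero_iff.2 (lt_of_lt_of_le hy (rayRadius_le hκ _ _))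

theorem mem_raySet_starshape (κ : ℝ) (E : Set (Eu N)) {e : Eu N} (he : ‖e‖ = 1) {t : ℝ}
    (ht : 0 < t) : t ∈ raySet (starshape κ E) e ↔ t < rayRadius κ E e := by
  have h1 : ‖t • e‖ = t := by rw [norm_smul, he, mul_one, Real.norm_of_nonneg ht.le]
  have h2 : t ∈ raySet (starshape κ E) e ↔ ‖t • e‖ < rayRadius κ E (‖t • e‖⁻¹ • t • e) :=
    ⟨fun h => h.2, fun h => ⟨ht, h⟩⟩
  rw [h2, h1, smul_smul, inv_mul_cancel₀ ht.ne', one_smul]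

theorem radialMeasure_raySet_starshape (hN : 2 ≤ N) {κ : ℝ} (hκ0 : 0 ≤ κ) (hκ1 : κ ≤ 1)
    {E : Set (Eu N)} (hr : ball 0 (1 - κ) ⊆ E) (hR : E ⊆ ball 0 (1 + κ)) {e : Eu N}
    (he : ‖e‖ = 1) :
    radialMeasure N (raySet (starshape κ E) e) = radialMeasure N (raySet E e) ∧
      radialMeasure N (raySet E e) < ⊤ := by
  have hN0 : (0 : ℝ) < N := by exact_mod_cast (by omega : 0 < N)
  have hnorm {t : ℝ} (ht : 0 < t) : ‖t • e‖ = t := by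
    rw [norm_smul, he, mul_one, Real.norm_of_nonneg ht.le]
  have hle : radialMeasure N (raySet E e) ≤ ENNReal.ofReal ((1 + κ) ^ N / N) := by
    have h1 := radialMeasure_Ico hN le_rfl (show 0 ≤ 1 + κ by linarith)
    rw [zero_pow (by omega), sub_zero] at h1
    rw [← h1]
    refine measure_mono fun t ht => ⟨ht.1.le, ?_⟩
    have := mem_ball_zero_iff.1 (hR ht.2)
    rwa [hnorm ht.1] at this
  have hge : ENNReal.ofReal ((1 - κ) ^ N / N) ≤ radialMeasure N (raySet E e) := by
    have h1 := radialMeasure_Ico hN le_rfl (show 0 ≤ 1 - κ by linarith)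
    rw [zero_pow (by omega), sub_zero] at h1
    rw [← h1, radialMeasure_congr (A := Set.Ico 0 (1 - κ)) (B := Set.Ioo 0 (1 - κ))
      fun t ht => ⟨fun h => ⟨ht, h.2⟩, fun h => ⟨ht.le, h.2⟩⟩]
    refine measure_mono fun t ht => ⟨ht.1, hr ?_⟩
    rw [mem_ball_zero_iff, hnorm ht.1]
    exact ht.2
  have hlt := hle.trans_lt ENNReal.ofReal_lt_top
  refine ⟨?_, hlt⟩
  set m := (radialMeasure N (raySet E e)).toReal with hm
  have hmm : radialMeasure N (raySet E e) = ENNReal.ofReal m := (ENNReal.ofReal_toReal hlt.ne).symm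
  have hm0 : 0 ≤ m := ENNReal.toReal_nonneg
  rw [hmm] at hle hge
  have h1 : m ≤ (1 + κ) ^ N / N := (ENNReal.ofReal_le_ofReal_iff (by positivity)).1 hle
  have h2 : (1 - κ) ^ N / N ≤ m := (ENNReal.ofReal_le_ofReal_iff hm0).1 hge
  rw [le_div_iff₀ hN0] at h1
  rw [div_le_iff₀ hN0] at h2
  set R := ((N : ℝ) * m) ^ ((N : ℝ)⁻¹) with hRdef
  have hR0 : 0 ≤ R := by positivity
  have hRN : R ^ N = N * m := Real.rpow_inv_natCast_pow (by positivity) (by omega)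
  have hR1 : R ≤ 1 + κ :=
    (pow_le_pow_iff_left₀ hR0 (by linarith) (by omega : N ≠ 0)).1 (by rw [hRN]; linarith)
  have hR2 : 1 - κ ≤ R :=
    (pow_le_pow_iff_left₀ (by linarith) hR0 (by omega : N ≠ 0)).1 (by rw [hRN]; linarith)
  have hRR : rayRadius κ E e = R := by
    rw [rayRadius, ← hm, ← hRdef, min_eq_right hR1, max_eq_right hR2]
  rw [radialMeasure_congr (B := Set.Ico 0 R) fun t ht => by
    rw [mem_raySet_starshape κ E he ht, hRR]
    exact ⟨fun h => ⟨ht.le, h⟩, fun h => h.2⟩, radialMeasure_Ico hN le_rfl hR0, hRN,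
    zero_pow (by omega), hmm]
  congr 1
  field_simp
  ring

theorem volume_starshape (hN : 2 ≤ N) {κ : ℝ} (hκ0 : 0 ≤ κ) (hκ1 : κ ≤ 1)
    {E : Set (Eu N)} (hE : MeasurableSet E) (hr : ball 0 (1 - κ) ⊆ E) (hR : E ⊆ ball 0 (1 + κ)) :
    volume (starshape κ E) = volume E := by
  rw [volume_eq_lintegral_raySet hN hE,
    volume_eq_lintegral_raySet hN (measurableSet_starshape κ hE)]
  refine lintegral_congr fun e => ?_
  exact (radialMeasure_raySet_starshape hN hκ0 hκ1 hr hR (norm_eq_of_mem_sphere e)).1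

theorem lintegral_sq_le {X : Type*} [MeasurableSpace X] {μ : Measure X} {f : X → ℝ≥0∞}
    (hf : AEMeasurable f μ) : (∫⁻ x, f x ∂μ) ^ 2 ≤ μ Set.univ * ∫⁻ x, f x ^ 2 ∂μ := by
  have h := ENNReal.lintegral_mul_le_Lp_mul_Lq μ Real.HolderConjugate.two_two hf
    (aemeasurable_const (b := (1 : ℝ≥0∞)))
  simp only [Pi.mul_apply, mul_one, ENNReal.one_rpow, lintegral_const, one_mul] at h
  have h2 (x : ℝ≥0∞) : (x ^ (1 / 2 : ℝ)) ^ 2 = x := by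
    rw [← ENNReal.rpow_natCast, ← ENNReal.rpow_mul]
    norm_num
  calc _ ≤ _ := pow_le_pow_left₀ bot_le h 2
    _ = _ := by
      rw [mul_pow, h2, h2, mul_comm]
      norm_cast

theorem setLIntegral_add_sq_le (hN : 2 ≤ N) {κ c : ℝ} (hκ0 : 0 ≤ κ) (hκ1 : κ ≤ 1) (hc : 0 ≤ c)
    {E : Set (Eu N)} (hE : MeasurableSet E) (hr : ball 0 (1 - κ) ⊆ E) (hR : E ⊆ ball 0 (1 + κ))
    {W : Eu N → ℝ≥0∞} (hW : Measurable W) (hd : ∀ e : Eu N, ‖e‖ = 1 → ∀ s t : ℝ, 1 - κ ≤ s →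
      s ≤ t → t ≤ 1 + κ → W (t • e) + ENNReal.ofReal (c * (t - s)) ≤ W (s • e)) :
    (∫⁻ x in E \ starshape κ E, W x) + ENNReal.ofReal (c / (4 * 2 ^ (N - 1))) *
      ((volume : Measure (Eu N)).toSphere Set.univ)⁻¹ * volume (E \ starshape κ E) ^ 2 ≤
      ∫⁻ x in starshape κ E \ E, W x := by
  set S := starshape κ E with hS
  have hSm : MeasurableSet S := measurableSet_starshape κ hE
  have hESm := hE.diff hSm
  set k := ENNReal.ofReal (c / (4 * 2 ^ (N - 1)))
  set σ := (volume : Measure (Eu N)).toSphere with hσ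
  have hm : Measurable fun e : sphere (0 : Eu N) 1 => radialMeasure N (raySet (E \ S) (e : Eu N)) :=
    (measurable_radialMeasure_raySet hESm).comp measurable_subtype_coe
  have hray (e : sphere (0 : Eu N) 1) :
      (∫⁻ t in raySet (E \ S) (e : Eu N), W (t • (e : Eu N)) ∂(radialMeasure N)) +
        k * radialMeasure N (raySet (E \ S) (e : Eu N)) ^ 2 ≤
      ∫⁻ t in raySet (S \ E) (e : Eu N), W (t • (e : Eu N)) ∂(radialMeasure N) := by
    have he : ‖(e : Eu N)‖ = 1 := norm_eq_of_mem_sphere e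
    have hnorm {t : ℝ} (ht : 0 < t) : ‖t • (e : Eu N)‖ = t := by
      rw [norm_smul, he, mul_one, Real.norm_of_nonneg ht.le]
    obtain ⟨hv, hlt⟩ := radialMeasure_raySet_starshape hN hκ0 hκ1 hr hR he
    have hdiff (F G : Set (Eu N)) : raySet (F \ G) (e : Eu N) = raySet F e \ raySet G e := by
      ext t
      exact ⟨fun h => ⟨⟨h.1, h.2.1⟩, fun h' => h.2.2 h'.2⟩,
        fun h => ⟨h.1.1, h.1.2, fun h' => h.2 ⟨h.1.1, h'⟩⟩⟩
    refine lintegral_add_sq_le (p := 1 - κ) (q := 1 + κ) (u := rayRadius κ E e) hc (by positivity)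
      (fun s t _ _ ht => radialMeasure_Ico_le N (by linarith)) (hd e he)
      (measurableSet_raySet hESm _) (measurableSet_raySet (hSm.diff hE) _) (fun t ht => ?_)
      (fun t ht => ?_) ?_ (le_rayRadius _ _ _) (rayRadius_le hκ0 _ _)
    · rw [hdiff] at ht
      refine ⟨not_lt.1 fun h => ht.2 ((mem_raySet_starshape κ E he ht.1.1).2 h), ?_⟩
      have h1 := mem_ball_zero_iff.1 (hR ht.1.2)
      rw [hnorm ht.1.1] at h1
      exact h1.le
    · rw [hdiff] at ht
      refine ⟨not_lt.1 fun h => ht.2 ⟨ht.1.1, hr ?_⟩, (mem_raySet_starshape κ E he ht.1.1).1 ht.1⟩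
      rwa [mem_ball_zero_iff, hnorm ht.1.1]
    · rw [hdiff, hdiff]
      exact measure_sdiff_comm (measurableSet_raySet hE _) (measurableSet_raySet hSm _) hv.symm hlt
  rw [setLIntegral_polar hN hESm hW, setLIntegral_polar hN (hSm.diff hE) hW]
  refine le_trans (add_le_add le_rfl ?_) ((le_lintegral_add _ _).trans (lintegral_mono hray))
  refine le_trans ?_ (lintegral_const_mul_le _ _)
  rw [mul_assoc]
  gcongr
  rw [volume_eq_lintegral_raySet hN hESm]
  refine (mul_le_mul_right (lintegral_sq_le hm.aemeasurable) _).trans ?_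
  rw [← mul_assoc]
  refine (mul_le_mul_left (ENNReal.inv_mul_le_one _) _).trans_eq (one_mul _)

/-- Moving the mass of a nearly spherical set towards the origin along rays increases its energy,
by at least a multiple of the square of the mass moved. -/
theorem exists_energy_starshape_ge (hN : 2 ≤ N) {a : ℝ} (ha0 : 0 < a) (ha : a + 1 < N) :
    ∃ (ε₁ : ℝ) (c : ℝ≥0∞), 0 < ε₁ ∧ ε₁ ≤ 1 / 4 ∧ 0 < c ∧ ∀ κ : ℝ, 0 ≤ κ → κ ≤ ε₁ →
      ∀ E : Set (Eu N), MeasurableSet E → ball 0 (1 - κ) ⊆ E → E ⊆ ball 0 (1 + κ) →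
      energy a E + c * volume (E \ starshape κ E) ^ 2 ≤ energy a (starshape κ E) := by
  obtain ⟨ε₁, c, hε0, hε1, hc, h⟩ := exists_potential_radial hN ha0 ha
  refine ⟨ε₁, _, hε0, hε1, ENNReal.mul_pos (a := ENNReal.ofReal (c / (4 * 2 ^ (N - 1))))
    (ENNReal.ofReal_pos.2 (by positivity)).ne' (ENNReal.inv_ne_zero.2
      (measure_ne_top (volume : Measure (Eu N)).toSphere Set.univ)),
    fun κ hκ0 hκ E hE hr hR => ?_⟩
  set S := starshape κ E with hS
  have hSm : MeasurableSet S := measurableSet_starshape κ hE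
  have hSr : ball 0 (1 - κ) ⊆ S := ball_subset_starshape κ E
  have hSR : S ⊆ ball 0 (1 + κ) := starshape_subset_ball hκ0 E
  have h1 : ball (0 : Eu N) (1 - ε₁) ⊆ ball 0 (1 - κ) := ball_subset_ball (by linarith)
  have h2 : ball (0 : Eu N) (1 + κ) ⊆ ball 0 (1 + ε₁) := ball_subset_ball (by linarith)
  have hpE := measurable_potential a E
  have hpS := measurable_potential a S
  have hW := setLIntegral_add_sq_le hN hκ0 (by linarith) hc.le hE hr hR
    (W := fun x => potential a E x + potential a S x) (hpE.add hpS)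
    fun e he s t hs hst ht => by
      rw [add_right_comm]
      exact add_le_add (h E hE (h1.trans hr) (hR.trans h2) e he s t (by linarith) hst (by linarith))
        (le_self_add.trans
          (h S hSm (h1.trans hSr) (hSR.trans h2) e he s t (by linarith) hst (by linarith)))
  rw [← hS] at hW
  set k := ENNReal.ofReal (c / (4 * 2 ^ (N - 1))) *
    ((volume : Measure (Eu N)).toSphere Set.univ)⁻¹ * volume (E \ S) ^ 2
  have hEd := lintegral_inter_add_sdiff (μ := volume) (fun x => potential a E x + potential a S x)
    E hSm
  have hSd := lintegral_inter_add_sdiff (μ := volume) (fun x => potential a E x + potential a S x)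
    S hE
  rw [Set.inter_comm] at hSd
  have h3 := add_le_add (le_refl (∫⁻ x in E ∩ S, (potential a E x + potential a S x))) hW
  rw [hSd, ← add_assoc, hEd, lintegral_add_left hpE, lintegral_add_left hpE,
    lintegral_potential_comm a S E] at h3
  have hfin : ∫⁻ x in E, potential a S x ≠ ⊤ := by
    refine ne_top_of_le_ne_top (energy_lt_top hN ha0 (by linarith : a < N) (E := ball 0 (1 + κ))
      (volume_ball_lt_top _ _)).ne ?_
    exact (lintegral_mono fun x => potential_mono a hSR x).trans (lintegral_mono_set hR)
  rw [add_right_comm, add_comm _ (∫⁻ x in S, potential a S x)] at h3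
  exact (ENNReal.add_le_add_iff_right hfin).1 h3

theorem asymmetry_le (E : Set (Eu N)) (x : Eu N) :
    asymmetry N E ≤ (volume (ball x 1 ∆ E)).toReal :=
  ciInf_le ⟨0, by rintro _ ⟨y, rfl⟩; exact ENNReal.toReal_nonneg⟩ x

theorem volume_symmDiff_lt_top {E G : Set (Eu N)} (hE : volume E < ⊤) (hG : volume G < ⊤) :
    volume (E ∆ G) < ⊤ :=
  (measure_mono Set.symmDiff_subset_union).trans_lt
    ((measure_union_le _ _).trans_lt (ENNReal.add_lt_top.2 ⟨hE, hG⟩))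

theorem asymmetry_le_add {E G : Set (Eu N)} (hE : volume E < ⊤) (hG : volume G < ⊤) :
    asymmetry N E ≤ asymmetry N G + (volume (G ∆ E)).toReal := by
  rw [← sub_le_iff_le_add]
  refine le_ciInf fun x => ?_
  rw [sub_le_iff_le_add]
  refine (asymmetry_le E x).trans ?_
  have h1 := (volume_symmDiff_lt_top (volume_ball_lt_top x 1) hG).ne
  have h2 := (volume_symmDiff_lt_top hG hE).ne
  rw [← ENNReal.toReal_add h1 h2]
  exact ENNReal.toReal_mono (ENNReal.add_ne_top.2 ⟨h1, h2⟩) (measure_symmDiff_le _ _ _)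

/-- The rearrangement step for sets centered at the origin. -/
theorem exists_starshape (hN : 2 ≤ N) {α : ℝ} (hα₁ : 1 < α) (hα₂ : α < N) :
    ∃ ε₁ C : ℝ, 0 < ε₁ ∧ 0 < C ∧ ∀ ε : ℝ, 0 < ε → ε < ε₁ → ∀ E : Set (Eu N), MeasurableSet E →
      volume E = volume (ball (0 : Eu N) 1) → ball 0 (1 - ε) ⊆ E → E ⊆ ball 0 (1 + ε) →
      C * √(deficit N α E) < asymmetry N E →
      ∃ κ : ℝ, 0 ≤ κ ∧ κ < ε ∧ ∃ G : Set (Eu N), MeasurableSet G ∧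
        volume (starshape κ G) = volume (ball (0 : Eu N) 1) ∧
        deficit N α (starshape κ G) ≤ deficit N α E ∧
        asymmetry N E / 2 ≤ asymmetry N (starshape κ G) := by
  set B := ball (0 : Eu N) 1 with hB
  set a : ℝ := N - α with ha
  have ha0 : 0 < a := by linarith
  have ha1 : a + 1 < N := by linarith
  have haN : a < N := by linarith
  have hBt : volume B < ⊤ := volume_ball_lt_top _ _
  have hBe : energy a B < ⊤ := energy_lt_top hN ha0 haN hBt
  obtain ⟨ε₁, c, hε0, hε1, hc0, hstar⟩ := exists_energy_starshape_ge hN ha0 ha1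
  obtain ⟨M, hMt, hM⟩ := exists_energy_le_add hN ha0 haN hBt
  have hmin0 : 0 < (min c 1).toReal :=
    ENNReal.toReal_pos (lt_min hc0 one_pos).ne' (min_lt_of_right_lt ENNReal.one_lt_top).ne
  set c' := (min c 1).toReal with hc'
  refine ⟨ε₁, 8 / √c', hε0, by positivity, fun ε hε hεε₁ E hE hv hr hR hlt => ?_⟩
  set δ := asymmetry N E with hδ
  have hδ0 : 0 < δ := lt_of_le_of_lt (by positivity) hlt
  have hEt : volume E < ⊤ := hv ▸ hBt
  have hne (x : Eu N) : volume (ball x 1 ∆ E) ≠ 0 := fun h => by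
    have := asymmetry_le E x
    rw [h, ENNReal.toReal_zero] at this
    linarith
  obtain ⟨F, hF, hFv, hFr, hFR, hFE, hFe⟩ := exists_energy_lt hN ha0 haN hE hv hr hR hne
    (ENNReal.ofReal_pos.2 (show 0 < δ / 16 by positivity))
  have hFt : volume F < ⊤ := hFv ▸ hBt
  have hgap : energy a F - energy a E ≠ 0 := (tsub_pos_of_lt hFe).ne'
  have hM1 : M + 1 ≠ ⊤ := ENNReal.add_ne_top.2 ⟨hMt.ne, ENNReal.one_ne_top⟩
  have hη : 0 < min (ENNReal.ofReal (δ / 16)) ((energy a F - energy a E) / (M + 1)) :=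
    lt_min (ENNReal.ofReal_pos.2 (by positivity)) (ENNReal.div_pos hgap hM1)
  obtain ⟨κ, hκ0, hκε, G, hG, hGv, hGr, hGR, hGF⟩ :=
    exists_truncation hN hε (by linarith) hF hFv hFr hFR hη
  have hGt : volume G < ⊤ := hGv ▸ hBt
  have hEG : energy a E ≤ energy a G := by
    have h1 := hM F G hFv.le hGv.le
    have h2 : M * volume (F \ G) ≤ energy a F - energy a E := by
      calc M * volume (F \ G) ≤ (M + 1) * ((energy a F - energy a E) / (M + 1)) :=
            mul_le_mul' le_self_add ((measure_mono Set.subset_union_right).trans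
              (hGF.le.trans (min_le_right _ _)))
        _ = _ := ENNReal.mul_div_cancel (by simp) hM1
    have h3 : energy a E + (energy a F - energy a E) ≤ energy a G + (energy a F - energy a E) := by
      rw [add_tsub_cancel_of_le hFe.le]
      exact h1.trans (add_le_add le_rfl h2)
    exact (ENNReal.add_le_add_iff_right
      (ne_top_of_le_ne_top (energy_lt_top hN ha0 haN hFt).ne tsub_le_self)).1 h3
  set S := starshape κ G with hS
  have hSm : MeasurableSet S := measurableSet_starshape κ hG
  have hSv : volume S = volume G := volume_starshape hN hκ0.le (by linarith) hG hGr hGR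
  have hSt : volume S < ⊤ := hSv ▸ hGt
  have hGS := hstar κ hκ0.le (by linarith) G hG hGr hGR
  have hSB : energy a S ≤ energy a B := energy_le_ball hN ha0 haN hSm (hSv.trans hGv)
    ((starshape_subset_ball hκ0.le G).trans (ball_subset_ball (by linarith)))
  have hen {X : Set (Eu N)} (hX : volume X < ⊤) : rieszEnergy N α X = (energy a X).toReal :=
    rieszEnergy_eq_toReal hN (by linarith) hα₂ hX
  have hene {X : Set (Eu N)} (hX : volume X < ⊤) : energy a X ≠ ⊤ :=
    (energy_lt_top hN ha0 haN hX).ne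
  refine ⟨κ, hκ0.le, hκε, G, hG, hSv.trans hGv, ?_, ?_⟩
  · rw [deficit, deficit, hen hSt, hen hEt]
    have := ENNReal.toReal_mono (hene hSt) (hEG.trans (le_self_add.trans hGS))
    linarith
  · have h1 := asymmetry_le_add hEt hFt
    have h2 := asymmetry_le_add hFt hGt
    have h3 := asymmetry_le_add hGt hSt
    have h4 : (volume (F ∆ E)).toReal ≤ δ / 16 :=
      ENNReal.toReal_le_of_le_ofReal (by positivity) hFE.le
    have h5 : (volume (G ∆ F)).toReal ≤ δ / 16 :=
      ENNReal.toReal_le_of_le_ofReal (by positivity) (hGF.le.trans (min_le_left _ _))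
    have hGSfin : volume (G \ S) ≠ ⊤ := measure_ne_top_of_subset Set.sdiff_subset hGt.ne
    set v := (volume (G \ S)).toReal with hvdef
    have hv0 : 0 ≤ v := ENNReal.toReal_nonneg
    have h6 : (volume (S ∆ G)).toReal = 2 * v := by
      rw [symmDiff_comm, volume_symmDiff_eq hG hSm hSv.symm hGt, ENNReal.toReal_mul]
      simp [hvdef]
    have h7 : c' * v ^ 2 ≤ deficit N α E := by
      have h8 : energy a E + min c 1 * volume (G \ S) ^ 2 ≤ energy a B :=
        (add_le_add hEG (mul_le_mul' (min_le_left _ _) le_rfl)).trans (hGS.trans hSB)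
      have h9 := ENNReal.toReal_mono hBe.ne h8
      rw [ENNReal.toReal_add (hene hEt) (ENNReal.mul_ne_top
        (min_lt_of_right_lt ENNReal.one_lt_top).ne (ENNReal.pow_ne_top hGSfin)),
        ENNReal.toReal_mul, ENNReal.toReal_pow] at h9
      rw [deficit, hen hEt, hen hBt]
      linarith
    have h8 : √c' * v ≤ √(deficit N α E) := by
      refine Real.le_sqrt_of_sq_le ?_
      rwa [mul_pow, Real.sq_sqrt hmin0.le]
    have h9 : 8 * v ≤ 8 / √c' * √(deficit N α E) := by
      rw [div_mul_eq_mul_div, le_div_iff₀ (by positivity)]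
      linarith
    rw [h6] at h3
    linarith

theorem rieszEnergy_congr {α : ℝ} {E G : Set (Eu N)} (h : E =ᵐ[volume] G) :
    rieszEnergy N α E = rieszEnergy N α G := by
  rw [rieszEnergy, rieszEnergy, Measure.restrict_congr_set h]

theorem asymmetry_congr {E G : Set (Eu N)} (h : E =ᵐ[volume] G) :
    asymmetry N E = asymmetry N G := by
  unfold asymmetry
  congr with x
  congr 1
  exact measure_congr (ae_eq_set_symmDiff Filter.EventuallyEq.rfl h)

theorem rieszEnergy_preimage_add {α : ℝ} (z : Eu N) (E : Set (Eu N)) :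
    rieszEnergy N α ((fun x => z + x) ⁻¹' E) = rieszEnergy N α E := by
  have hmp := measurePreserving_add_left (volume : Measure (Eu N)) z
  have hme : MeasurableEmbedding fun x : Eu N => z + x := measurableEmbedding_addLeft z
  rw [rieszEnergy, rieszEnergy,
    ← hmp.setIntegral_preimage_emb hme (fun x => ∫ y in E, ‖y - x‖ ^ (α - (N : ℝ))) E]
  refine integral_congr_ae (Filter.Eventually.of_forall fun x => ?_)
  simp only
  rw [← hmp.setIntegral_preimage_emb hme (fun y => ‖y - (z + x)‖ ^ (α - (N : ℝ))) E]
  simp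

theorem asymmetry_preimage_add (z : Eu N) (E : Set (Eu N)) :
    asymmetry N ((fun x => z + x) ⁻¹' E) = asymmetry N E := by
  unfold asymmetry
  refine (Equiv.addLeft z).iInf_congr fun x => ?_
  have h : ball x 1 = (fun y => z + y) ⁻¹' ball (z + x) 1 := by
    ext y
    simp [mem_ball]
  rw [h, ← Set.preimage_symmDiff, measure_preimage_add]
  rfl

theorem rays_ae_eq_starshape {κ : ℝ} (hN : 2 ≤ N) (E : Set (Eu N)) :
    {p : Eu N | ∃ x ∈ sphere (0 : Eu N) 1, ∃ t : ℝ, (t ∈ Set.Ico 0 (1 - max (1 - rayRadius κ E x) 0) ∪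
      Set.Ioo 1 (1 + max (rayRadius κ E x - 1) 0)) ∧ p = t • x} =ᵐ[volume] starshape κ E := by
  have hN' : Nontrivial (Eu N) := by
    have : Nonempty (Fin N) := ⟨⟨0, by omega⟩⟩
    infer_instance
  filter_upwards [compl_mem_ae_iff.2 (measure_singleton (0 : Eu N)),
    compl_mem_ae_iff.2 (Measure.addHaar_sphere volume (0 : Eu N) 1)] with y hy0 hy1
  have hy0 : 0 < ‖y‖ := norm_pos_iff.2 hy0
  have hy1 : ‖y‖ ≠ 1 := fun h => hy1 (mem_sphere_zero_iff_norm.2 h)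
  refine propext ⟨?_, fun (h : ‖y‖ < rayRadius κ E (‖y‖⁻¹ • y)) => ?_⟩
  · rintro ⟨x, hx, t, ht, rfl⟩
    have hx1 : ‖x‖ = 1 := mem_sphere_zero_iff_norm.1 hx
    have ht0 : 0 ≤ t := ht.elim (fun h => h.1) fun h => zero_le_one.trans h.1.le
    have hn : ‖t • x‖ = t := by rw [norm_smul, hx1, mul_one, Real.norm_of_nonneg ht0]
    change ‖t • x‖ < rayRadius κ E (‖t • x‖⁻¹ • t • x)
    rw [hn] at hy0
    rw [hn, smul_smul, inv_mul_cancel₀ hy0.ne', one_smul]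
    rcases ht with ht | ht
    · have := le_max_left (1 - rayRadius κ E x) 0
      linarith [ht.2]
    · rcases lt_max_iff.1 (show t - 1 < max (rayRadius κ E x - 1) 0 by linarith [ht.2]) with h | h
      · linarith
      · linarith [ht.1]
  · refine ⟨‖y‖⁻¹ • y, mem_sphere_zero_iff_norm.2 ?_, ‖y‖, ?_, ?_⟩
    · rw [norm_smul, norm_inv, norm_norm, inv_mul_cancel₀ hy0.ne']
    · rcases lt_or_gt_of_ne hy1 with h1 | h1
      · refine Or.inl ⟨hy0.le, ?_⟩
        have := max_lt (show 1 - rayRadius κ E (‖y‖⁻¹ • y) < 1 - ‖y‖ by linarith)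
          (show 0 < 1 - ‖y‖ by linarith)
        linarith
      · refine Or.inr ⟨h1, ?_⟩
        have := le_max_left (rayRadius κ E (‖y‖⁻¹ • y) - 1) 0
        linarith
    · rw [smul_smul, mul_inv_cancel₀ hy0.ne', one_smul]

end RieszRearrangement

open RieszRearrangement in
theorem radial_rearrangement_step (N : ℕ) (hN : 2 ≤ N) (α : ℝ) (hα₁ : 1 < α) (hα₂ : α < N) :
    ∃ ε₁ C : ℝ, 0 < ε₁ ∧ 0 < C ∧
      ∀ ε : ℝ, 0 < ε → ε < ε₁ → ∀ z : EuclideanSpace ℝ (Fin N),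
      ∀ E' : Set (EuclideanSpace ℝ (Fin N)), MeasurableSet E' →
        volume E' = volume (ball (0 : EuclideanSpace ℝ (Fin N)) 1) →
        ball z (1 - ε) ⊆ E' → E' ⊆ ball z (1 + ε) →
        C * Real.sqrt (deficit N α E') < asymmetry N E' →
        ∃ uplus uminus : EuclideanSpace ℝ (Fin N) → ℝ,
          Measurable uplus ∧ Measurable uminus ∧
          (∀ x ∈ sphere (0 : EuclideanSpace ℝ (Fin N)) 1, uplus x ∈ Set.Ico (0 : ℝ) ε) ∧
          (∀ x ∈ sphere (0 : EuclideanSpace ℝ (Fin N)) 1, uminus x ∈ Set.Ico (0 : ℝ) ε) ∧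
          volume {p : EuclideanSpace ℝ (Fin N) |
              ∃ x ∈ sphere (0 : EuclideanSpace ℝ (Fin N)) 1, ∃ t : ℝ,
                (t ∈ Set.Ico (0 : ℝ) (1 - uminus x) ∪ Set.Ioo 1 (1 + uplus x)) ∧
                p = z + t • x} =
            volume (ball (0 : EuclideanSpace ℝ (Fin N)) 1) ∧
          deficit N α {p : EuclideanSpace ℝ (Fin N) |
              ∃ x ∈ sphere (0 : EuclideanSpace ℝ (Fin N)) 1, ∃ t : ℝ,
                (t ∈ Set.Ico (0 : ℝ) (1 - uminus x) ∪ Set.Ioo 1 (1 + uplus x)) ∧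
                p = z + t • x} ≤ deficit N α E' ∧
          asymmetry N {p : EuclideanSpace ℝ (Fin N) |
              ∃ x ∈ sphere (0 : EuclideanSpace ℝ (Fin N)) 1, ∃ t : ℝ,
                (t ∈ Set.Ico (0 : ℝ) (1 - uminus x) ∪ Set.Ioo 1 (1 + uplus x)) ∧
                p = z + t • x} ≥ asymmetry N E' / 2 := by
  obtain ⟨ε₁, C, hε₁, hC, h⟩ := exists_starshape hN hα₁ hα₂
  refine ⟨ε₁, C, hε₁, hC, fun ε hε hεε₁ z E hE hv hr hR hlt => ?_⟩
  have hball (r : ℝ) : (fun x => z + x) ⁻¹' ball z r = ball 0 r := by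
    ext y
    simp [mem_ball, dist_eq_norm]
  have hdef (X : Set (Eu N)) : deficit N α ((fun x => z + x) ⁻¹' X) = deficit N α X := by
    rw [deficit, deficit, rieszEnergy_preimage_add]
  obtain ⟨κ, hκ0, hκε, G, hG, hGv, hGd, hGa⟩ := h ε hε hεε₁ ((fun x => z + x) ⁻¹' E)
    ((measurable_const_add z) hE) (by rw [measure_preimage_add, hv])
    (by rw [← hball]; exact Set.preimage_mono hr) (by rw [← hball]; exact Set.preimage_mono hR)
    (by rwa [hdef, asymmetry_preimage_add])
  rw [hdef] at hGd
  rw [asymmetry_preimage_add] at hGa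
  have hm := measurable_rayRadius κ hG
  refine ⟨fun x => max (rayRadius κ G x - 1) 0, fun x => max (1 - rayRadius κ G x) 0,
    by fun_prop, by fun_prop, fun x _ => ⟨le_max_right _ _, max_lt ?_ hε⟩,
    fun x _ => ⟨le_max_right _ _, max_lt ?_ hε⟩, ?_⟩
  · linarith [rayRadius_le hκ0 G x]
  · linarith [le_rayRadius κ G x]
  set P := {p : Eu N | ∃ x ∈ sphere (0 : Eu N) 1, ∃ t : ℝ,
    (t ∈ Set.Ico (0 : ℝ) (1 - max (1 - rayRadius κ G x) 0) ∪
      Set.Ioo 1 (1 + max (rayRadius κ G x - 1) 0)) ∧ p = z + t • x} with hP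
  have hPS : (fun x => z + x) ⁻¹' P =ᵐ[volume] starshape κ G := by
    refine Filter.EventuallyEq.trans (Filter.EventuallyEq.of_eq ?_) (rays_ae_eq_starshape hN G)
    ext y
    simp [hP]
  refine ⟨?_, ?_, ?_⟩
  · rw [← measure_preimage_add volume z P, measure_congr hPS, hGv]
  · rw [← hdef P, deficit, rieszEnergy_congr hPS]
    exact hGd
  · rw [← asymmetry_preimage_add z P, asymmetry_congr hPS]
    exact hGa
end

section
/- Let N ≥ 1 and let F : \overline{B} → \overline{B} be a continuous map from the closed unit ball of ℝ^N to itself whose restriction f to the unit sphere 𝕊^{N−1} satisfies f(𝕊^{N−1}) ⊆ 𝕊^{N−1} and f(x) ≠ −x for every x ∈ 𝕊^{N−1}. Then there exists x in the closed unit ball with F(x) = 0. -/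
open Metric

open MeasureTheory Polynomial in
theorem exists_weights_det_one_add_smul (E : Type*) [NormedAddCommGroup E] [NormedSpace ℝ E]
    [FiniteDimensional ℝ E] (s : Finset ℝ) (hs : Module.finrank ℝ E < s.card) :
    ∃ c : ℝ → ℝ, ∑ t ∈ s, c t = 1 ∧
      ∀ A : E →L[ℝ] E, (1 + A).det = ∑ t ∈ s, c t * (1 + t • A).det := by
  have hne : s.Nonempty := Finset.card_pos.1 (by omega)
  refine ⟨fun t => (Lagrange.basis s id t).eval 1, ?_, fun A => ?_⟩
  · rw [← eval_finsetSum, Lagrange.sum_basis (Set.injOn_id _) hne, eval_one]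
  · let b := Module.finBasis ℝ E
    let M := LinearMap.toMatrix b b (A : E →ₗ[ℝ] E)
    let q : ℝ[X] := Matrix.det ((X : ℝ[X]) • M.map C + (1 : Matrix _ _ ℝ).map C)
    have hdet : ∀ t : ℝ, q.eval t = (1 + t • A).det := by
      intro t
      have hM : LinearMap.toMatrix b b ((1 + t • A : E →L[ℝ] E) : E →ₗ[ℝ] E) = t • M + 1 := by
        rw [ContinuousLinearMap.toLinearMap_add, ContinuousLinearMap.toLinearMap_smul, map_add,
          map_smul, add_comm]
        congr 1
        exact LinearMap.toMatrix_one b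
      rw [ContinuousLinearMap.det, ← LinearMap.det_toMatrix b, hM]
      simp only [q, eval_det]
      congr 1
      ext i j
      simp [Matrix.one_apply, mul_comm]
    have hdeg : q.degree < s.card := by
      refine lt_of_le_of_lt degree_le_natDegree ?_
      have := natDegree_det_X_add_C_le M (1 : Matrix _ _ ℝ)
      rw [Fintype.card_fin] at this
      exact_mod_cast this.trans_lt hs
    have h := Lagrange.eq_interpolate (v := id) (Set.injOn_id _) hdeg
    have h1 := congrArg (eval 1) h
    rw [Lagrange.interpolate_apply, eval_finsetSum, hdet 1, one_smul] at h1
    rw [h1]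
    refine Finset.sum_congr rfl fun t _ => ?_
    rw [eval_mul, eval_C, id, hdet, mul_comm]

theorem det_one_add_smul_pos {E : Type*} [NormedAddCommGroup E] [NormedSpace ℝ E]
    [FiniteDimensional ℝ E] {A : E →L[ℝ] E} (hA : ‖A‖ < 1) : 0 < (1 + A).det := by
  have hne : ∀ s ∈ Set.Icc (0 : ℝ) 1, (1 + s • A).det ≠ 0 := by
    intro s hs h0
    have hlt : ‖-(s • A)‖ < 1 := by
      rw [norm_neg, norm_smul, Real.norm_of_nonneg hs.1]
      nlinarith [hs.1, hs.2, norm_nonneg A]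
    have hu : IsUnit (1 + s • A) := by
      simpa using isUnit_one_sub_of_norm_lt_one hlt
    have := hu.map (ContinuousLinearMap.toLinearMapRingHom (R₁ := ℝ) (M₁ := E))
    have := this.map (LinearMap.det (A := ℝ) (M := E))
    exact this.ne_zero h0
  have hcont : Continuous fun s : ℝ => (1 + s • A).det :=
    ContinuousLinearMap.continuous_det.comp (by fun_prop)
  by_contra! hle
  obtain ⟨s, hs, h0⟩ := intermediate_value_Icc' (zero_le_one (α := ℝ)) hcont.continuousOn
    (show (0 : ℝ) ∈ Set.Icc _ _ by
      refine ⟨by simpa using hle, ?_⟩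
      simp [ContinuousLinearMap.det, ContinuousLinearMap.one_def])
  exact hne s hs h0

theorem LipschitzOnWith.lipschitzWith_of_eq_zero_off_ball {E : Type*} [NormedAddCommGroup E]
    [NormedSpace ℝ E] {R : ℝ} {K : NNReal} {φ : E → E}
    (hφ : LipschitzOnWith K φ (closedBall 0 R)) (h0 : ∀ x, R ≤ ‖x‖ → φ x = 0) :
    LipschitzWith K φ := by
  have key : ∀ x y, ‖x‖ ≤ R → R ≤ ‖y‖ → ‖φ x - φ y‖ ≤ K * ‖x - y‖ := by
    intro x y hx hy
    obtain ⟨s, hs, hsR⟩ := intermediate_value_Icc (zero_le_one (α := ℝ))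
      (f := fun s : ℝ => ‖x + s • (y - x)‖) (by fun_prop)
      (show R ∈ Set.Icc _ _ by simpa using ⟨hx, hy⟩)
    dsimp only at hsR
    have h1 := hφ.norm_sub_le (x := x) (y := x + s • (y - x)) (by simpa using hx)
      (by simpa using hsR.le)
    rw [h0 _ hsR.ge] at h1
    rw [h0 _ hy]
    refine h1.trans ?_
    gcongr
    rw [sub_add_cancel_left, norm_neg, norm_smul, Real.norm_of_nonneg hs.1, norm_sub_rev x y]
    exact mul_le_of_le_one_left (norm_nonneg _) hs.2
  refine LipschitzWith.of_dist_le_mul fun x y => ?_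
  rw [dist_eq_norm, dist_eq_norm]
  rcases le_total ‖x‖ R with hx | hx <;> rcases le_total ‖y‖ R with hy | hy
  · exact hφ.norm_sub_le (by simpa using hx) (by simpa using hy)
  · exact key x y hx hy
  · rw [norm_sub_rev, norm_sub_rev x]
    exact key y x hy hx
  · rw [h0 x hx, h0 y hy, sub_zero, norm_zero]
    positivity

open MeasureTheory in
theorem setIntegral_det_one_add_smul_fderiv_sub {E : Type*} [NormedAddCommGroup E]
    [InnerProductSpace ℝ E] [FiniteDimensional ℝ E] [MeasurableSpace E] [BorelSpace E]
    {R : ℝ} {K : NNReal} {r : E → E} (hr : Differentiable ℝ r)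
    (hK : LipschitzOnWith K (fun x => r x - x) (closedBall 0 R))
    (hnorm : ∀ x, ‖r x‖ = R) (hfix : ∀ x, ‖x‖ = R → r x = x)
    {t : ℝ} (ht0 : 0 < t) (ht1 : t < 1) (htK : t * K < 1) :
    ∫ x in ball (0 : E) R, (1 + t • (fderiv ℝ r x - 1)).det = volume.real (ball (0 : E) R) := by
  let φ : E → E := fun x => if ‖x‖ ≤ R then r x - x else 0
  have hφin : ∀ x, ‖x‖ ≤ R → φ x = r x - x := fun x hx => if_pos hx
  have hφout : ∀ x, R ≤ ‖x‖ → φ x = 0 := by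
    intro x hx
    rcases hx.eq_or_lt with h | h
    · rw [hφin x h.ge, hfix x h.symm, sub_self]
    · exact if_neg h.not_ge
  have hφ : LipschitzWith K φ := by
    refine LipschitzOnWith.lipschitzWith_of_eq_zero_off_ball (R := R) ?_ hφout
    intro x hx y hy
    rw [hφin x (by simpa using hx), hφin y (by simpa using hy)]
    exact hK hx hy
  let h : E → E := fun x => x + t • (r x - x)
  have hd : ∀ x ∈ ball (0 : E) R,
      HasFDerivWithinAt h (1 + t • (fderiv ℝ r x - 1)) (ball 0 R) x := by
    intro x _
    exact ((hasFDerivAt_id x).add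
      (((hr x).hasFDerivAt.sub (hasFDerivAt_id x)).const_smul t)).hasFDerivWithinAt
  have hinj : Set.InjOn h (ball 0 R) := by
    intro x hx y hy hxy
    have h1 := hK.norm_sub_le (ball_subset_closedBall hx) (ball_subset_closedBall hy)
    have h2 : x - y = -(t • ((r x - x) - (r y - y))) := by
      have : x + t • (r x - x) = y + t • (r y - y) := hxy
      rw [smul_sub t (r x - x), neg_sub, sub_eq_sub_iff_add_eq_add, this, add_comm]
    have h3 : ‖x - y‖ ≤ t * K * ‖x - y‖ := by
      conv_lhs => rw [h2, norm_neg, norm_smul, Real.norm_of_nonneg ht0.le]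
      rw [mul_assoc]
      gcongr
    rw [← sub_eq_zero, ← norm_eq_zero]
    nlinarith [norm_nonneg (x - y)]
  have himg : h '' ball 0 R = ball 0 R := by
    apply Set.Subset.antisymm
    · rintro _ ⟨x, hx, rfl⟩
      rw [mem_ball_zero_iff] at hx ⊢
      have : h x = (1 - t) • x + t • r x := by simp only [h]; module
      rw [this]
      calc _ ≤ ‖(1 - t) • x‖ + ‖t • r x‖ := norm_add_le _ _
        _ = (1 - t) * ‖x‖ + t * R := by
          rw [norm_smul, norm_smul, hnorm, Real.norm_of_nonneg ht0.le,
            Real.norm_of_nonneg (by linarith)]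
        _ < R := by nlinarith
    · intro y hy
      have hc : ContractingWith (Real.toNNReal t * K) fun x => y - t • φ x := by
        refine ⟨?_, LipschitzWith.of_dist_le_mul fun a b => ?_⟩
        · rw [← NNReal.coe_lt_coe]
          simpa [ht0.le] using htK
        · rw [dist_eq_norm, dist_eq_norm, sub_sub_sub_cancel_left, ← smul_sub, norm_smul,
            norm_sub_rev a b, Real.norm_of_nonneg ht0.le, NNReal.coe_mul,
            Real.coe_toNNReal _ ht0.le, mul_assoc]
          gcongr
          exact hφ.norm_sub_le b a
      have hx := hc.fixedPoint_isFixedPt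
      set x := hc.fixedPoint
      have hx' : y - t • φ x = x := hx
      have hxR : ‖x‖ < R := by
        by_contra! hge
        rw [hφout x hge, smul_zero, sub_zero] at hx'
        rw [mem_ball_zero_iff, hx'] at hy
        linarith
      refine ⟨x, by simpa using hxR, ?_⟩
      rw [hφin x hxR.le, sub_eq_iff_eq_add] at hx'
      exact hx'.symm
  have hcv := integral_image_eq_integral_abs_det_fderiv_smul (volume : Measure E)
    measurableSet_ball hd hinj (fun _ => (1 : ℝ))
  rw [himg, setIntegral_const, smul_eq_mul, mul_one] at hcv
  rw [hcv]
  refine setIntegral_congr_fun measurableSet_ball fun x hx => ?_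
  rw [smul_eq_mul, mul_one, abs_of_pos]
  apply det_one_add_smul_pos
  have hfd : fderiv ℝ r x - 1 = fderiv ℝ (fun x => r x - x) x :=
    (((hr x).hasFDerivAt.sub (hasFDerivAt_id x))).fderiv.symm
  have := norm_fderiv_le_of_lipschitzOn ℝ (closedBall_mem_nhds_of_mem hx) hK
  rw [norm_smul, Real.norm_of_nonneg ht0.le, hfd]
  exact (mul_le_mul_of_nonneg_left this ht0.le).trans_lt htK

theorem det_fderiv_eq_zero_of_norm_const {E : Type*} [NormedAddCommGroup E]
    [InnerProductSpace ℝ E] [FiniteDimensional ℝ E] {R : ℝ} (hR : 0 < R) {r : E → E} {x : E}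
    (hr : DifferentiableAt ℝ r x) (hnorm : ∀ x, ‖r x‖ = R) : (fderiv ℝ r x).det = 0 := by
  by_contra hne
  obtain ⟨v, hv⟩ := (LinearMap.equivOfDetNeZero (fderiv ℝ r x : E →ₗ[ℝ] E) hne).surjective (r x)
  have hv' : fderiv ℝ r x v = r x := hv
  have h1 := (hr.hasFDerivAt.inner ℝ hr.hasFDerivAt)
  have h2 : HasFDerivAt (fun y => inner ℝ (r y) (r y)) (0 : E →L[ℝ] ℝ) x := by
    simp_rw [real_inner_self_eq_norm_sq, hnorm]
    exact hasFDerivAt_const _ _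
  have h3 := DFunLike.congr_fun (h1.unique h2) v
  simp [hv', hnorm] at h3
  nlinarith

open MeasureTheory in
theorem not_contDiff_retraction_sphere {E : Type*} [NormedAddCommGroup E]
    [InnerProductSpace ℝ E] [FiniteDimensional ℝ E] {R : ℝ} (hR : 0 < R) {r : E → E}
    (hr : ContDiff ℝ 1 r) (hnorm : ∀ x, ‖r x‖ = R) (hfix : ∀ x, ‖x‖ = R → r x = x) : False := by
  borelize E
  obtain ⟨K, hK⟩ := (hr.sub contDiff_id).contDiffOn.exists_lipschitzOnWith one_ne_zero
    (convex_closedBall (0 : E) R) (isCompact_closedBall _ _)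
  have hδ : 0 < min 1 (1 / ((K : ℝ) + 1)) := by positivity
  obtain ⟨s, hs, hcard⟩ := (Set.Ioo_infinite hδ).exists_subset_card_eq (Module.finrank ℝ E + 1)
  obtain ⟨c, hc1, hc⟩ := exists_weights_det_one_add_smul E s (by omega)
  have hcont : ∀ t : ℝ, Continuous fun x => (1 + t • (fderiv ℝ r x - 1)).det := fun t =>
    ContinuousLinearMap.continuous_det.comp
      (continuous_const.add (((hr.continuous_fderiv one_ne_zero).sub continuous_const).const_smul t))
  have hzero : ∫ x in ball (0 : E) R, (1 + (fderiv ℝ r x - 1)).det = 0 := by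
    simp [det_fderiv_eq_zero_of_norm_const hR (hr.differentiable one_ne_zero _) hnorm]
  rw [integral_congr_ae (.of_forall fun x => hc (fderiv ℝ r x - 1))] at hzero
  rw [integral_finsetSum _ fun t _ => (((hcont t).continuousOn.integrableOn_compact
    (isCompact_closedBall 0 R)).mono_set ball_subset_closedBall).const_mul _] at hzero
  have hsum : ∑ t ∈ s, ∫ x in ball (0 : E) R, c t * (1 + t • (fderiv ℝ r x - 1)).det
      = volume.real (ball (0 : E) R) := by
    rw [← one_mul (volume.real _), ← hc1, Finset.sum_mul]
    refine Finset.sum_congr rfl fun t ht => ?_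
    obtain ⟨h0, h1⟩ := hs ht
    rw [lt_min_iff, lt_div_iff₀ (by positivity)] at h1
    rw [integral_const_mul, setIntegral_det_one_add_smul_fderiv_sub
      (hr.differentiable one_ne_zero) hK hnorm hfix h0 h1.1 (by nlinarith)]
  rw [hsum] at hzero
  exact (ENNReal.toReal_pos (measure_ball_pos volume (0 : E) hR).ne'
    measure_ball_lt_top.ne).ne' hzero

/-- A continuous self-map of a Euclidean space which is the identity off a ball has a zero. -/
theorem exists_eq_zero_of_eq_id_off_ball {E : Type*} [NormedAddCommGroup E]
    [InnerProductSpace ℝ E] [FiniteDimensional ℝ E] {R : ℝ} (hR : 0 < R) {w : E → E}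
    (hw : Continuous w) (hid : ∀ x, R ≤ ‖x‖ → w x = x) : ∃ x, w x = 0 := by
  by_contra! hne
  obtain ⟨g, hg, happ, hsupp⟩ := (hw.sub continuous_id).exists_contDiff_approx 1
    hw.norm (fun x => norm_pos_iff.2 (hne x))
  have hgne : ∀ x, x + g x ≠ 0 := by
    intro x hx
    have h1 := happ x
    rw [dist_eq_norm, eq_neg_of_add_eq_zero_right hx] at h1
    simp only [Pi.sub_apply, id] at h1
    rw [neg_sub_left, norm_neg, sub_add_cancel] at h1
    exact lt_irrefl _ h1
  have hg0 : ∀ x, R ≤ ‖x‖ → g x = 0 := fun x hx => by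
    by_contra h
    exact hsupp h (by simp [hid x hx])
  have hsmooth : ContDiff ℝ 1 fun x => x + g x := contDiff_id.add hg
  refine not_contDiff_retraction_sphere hR (r := fun x => (R * ‖x + g x‖⁻¹) • (x + g x))
    ((contDiff_const.mul ((hsmooth.norm ℝ hgne).inv fun x => norm_ne_zero_iff.2 (hgne x))).smul
      hsmooth) (fun x => ?_) (fun x hx => ?_)
  · rw [norm_smul, norm_mul, norm_inv, norm_norm, Real.norm_of_nonneg hR.le, mul_assoc,
      inv_mul_cancel₀ (norm_ne_zero_iff.2 (hgne x)), mul_one]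
  · simp [hg0 x hx.ge, hx, hR.ne']

theorem zero_of_boundary_not_antipodal (N : ℕ) (hN : 1 ≤ N)
    (F : EuclideanSpace ℝ (Fin N) → EuclideanSpace ℝ (Fin N))
    (hFcont : ContinuousOn F (closedBall (0 : EuclideanSpace ℝ (Fin N)) 1))
    (hFmaps : Set.MapsTo F (closedBall (0 : EuclideanSpace ℝ (Fin N)) 1)
      (closedBall (0 : EuclideanSpace ℝ (Fin N)) 1))
    (hsphere : ∀ x ∈ sphere (0 : EuclideanSpace ℝ (Fin N)) 1,
      F x ∈ sphere (0 : EuclideanSpace ℝ (Fin N)) 1)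
    (hantipodal : ∀ x ∈ sphere (0 : EuclideanSpace ℝ (Fin N)) 1, F x ≠ -x) :
    ∃ x ∈ closedBall (0 : EuclideanSpace ℝ (Fin N)) 1, F x = 0 := by
  let clip : EuclideanSpace ℝ (Fin N) → EuclideanSpace ℝ (Fin N) := fun x => (max 1 ‖x‖)⁻¹ • x
  have hmax : ∀ x : EuclideanSpace ℝ (Fin N), 0 < max 1 ‖x‖ := fun x => by positivity
  have hclip : Continuous clip :=
    ((continuous_const.max continuous_norm).inv₀ fun x => (hmax x).ne').smul continuous_id
  have hclip_norm : ∀ x, ‖clip x‖ = (max 1 ‖x‖)⁻¹ * ‖x‖ := fun x => by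
    rw [norm_smul, norm_inv, Real.norm_of_nonneg (hmax x).le]
  have hclip_mem : ∀ x, clip x ∈ closedBall (0 : EuclideanSpace ℝ (Fin N)) 1 := fun x => by
    rw [mem_closedBall_zero_iff, hclip_norm, inv_mul_le_iff₀ (hmax x), mul_one]
    exact le_max_right _ _
  let s : EuclideanSpace ℝ (Fin N) → ℝ := fun x => max 0 (min 1 (‖x‖ - 1))
  have hs : Continuous s := by fun_prop
  have hs0 : ∀ x, 0 ≤ s x := fun x => le_max_left _ _
  have hs1 : ∀ x, s x ≤ 1 := fun x => max_le zero_le_one (min_le_left _ _)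
  obtain ⟨x, hx⟩ := exists_eq_zero_of_eq_id_off_ball (R := 2) two_pos
    (w := fun x => (1 - s x) • F (clip x) + s x • x)
    (((continuous_const.sub hs).smul (hFcont.comp_continuous hclip hclip_mem)).add
      (hs.smul continuous_id))
    (fun x hx => by
      have : s x = 1 := by
        simp only [s]
        rw [min_eq_left (by linarith), max_eq_right zero_le_one]
      simp [this])
  rcases le_or_gt ‖x‖ 1 with hx1 | hx1
  · have h0 : s x = 0 := max_eq_left ((min_le_right _ _).trans (by linarith))
    exact ⟨clip x, hclip_mem x, by simpa [h0] using hx⟩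
  · exfalso
    have hxpos : 0 < ‖x‖ := by linarith
    have hclipx : clip x = ‖x‖⁻¹ • x := by simp only [clip, max_eq_right hx1.le]
    have hmem : clip x ∈ sphere (0 : EuclideanSpace ℝ (Fin N)) 1 := by
      rw [mem_sphere_zero_iff_norm, hclip_norm, max_eq_right hx1.le, inv_mul_cancel₀ hxpos.ne']
    have hF1 := mem_sphere_zero_iff_norm.1 (hsphere _ hmem)
    have heq := eq_neg_of_add_eq_zero_left hx
    have hn := congrArg norm heq
    rw [norm_neg, norm_smul, norm_smul, hF1, Real.norm_of_nonneg (hs0 x),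
      Real.norm_of_nonneg (by linarith [hs1 x]), mul_one] at hn
    have hlt : 0 < 1 - s x := by
      rcases (hs1 x).eq_or_lt with h | h
      · rw [h] at hn; linarith
      · linarith
    refine hantipodal _ hmem (smul_right_injective _ hlt.ne' ?_)
    dsimp only
    rw [heq, hclipx, hn, smul_neg, smul_smul, mul_assoc, mul_inv_cancel₀ hxpos.ne', mul_one]
end
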